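/- arXiv:2503.13727 — 2 statements merged into one kernel-verified Lean document; each statement's English description precedes it below -/
import Mathlib

section
/- Suppose X ⊆ ℕ is loquaciously high for descending sequences and Y ⊆ ℕ is of PA degree over X, i.e., every infinite X-computable binary tree has a Y-computable infinite path. Then Y is loquaciously high for paths. -/
namespace CFT

open Nat.Partrec (Code)

/-- Relativized partial recursive functions: `f` is partial recursive in the
(total) oracle `O : ℕ → ℕ`.  This mirrors Mathlib's `Nat.Partrec`, with an
extra constructor for the oracle. -/
inductive RecursiveIn (O : ℕ → ℕ) : (ℕ →. ℕ) → Prop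
  | zero : RecursiveIn O (pure 0)
  | succ : RecursiveIn O Nat.succ
  | left : RecursiveIn O ↑fun n : ℕ => n.unpair.1
  | right : RecursiveIn O ↑fun n : ℕ => n.unpair.2
  | oracle : RecursiveIn O ↑O
  | pair {f g} : RecursiveIn O f → RecursiveIn O g →
      RecursiveIn O fun n => Nat.pair <$> f n <*> g n
  | comp {f g} : RecursiveIn O f → RecursiveIn O g →
      RecursiveIn O fun n => g n >>= f
  | prec {f g} : RecursiveIn O f → RecursiveIn O g →
      RecursiveIn O (Nat.unpaired fun a n =>
        n.rec (f a) fun y IH => do let i ← IH; g (Nat.pair a (Nat.pair y i)))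
  | rfind {f} : RecursiveIn O f →
      RecursiveIn O fun a => Nat.rfind fun n => (fun m => m = 0) <$> f (Nat.pair a n)

/-- Partial functions between `Primcodable` types that are partial recursive in
the oracle `O`. -/
def PartrecIn (O : ℕ → ℕ) {α σ : Type} [Primcodable α] [Primcodable σ] (f : α →. σ) : Prop :=
  RecursiveIn O fun n =>
    Part.bind (Part.ofOption (Encodable.decode (α := α) n)) fun a => (f a).map Encodable.encode

/-- Total functions between `Primcodable` types that are computable in the oracle `O`. -/
def ComputableIn (O : ℕ → ℕ) {α σ : Type} [Primcodable α] [Primcodable σ] (f : α → σ) : Prop :=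
  PartrecIn O (f : α →. σ)

open Classical in
/-- The characteristic function of a set of naturals. -/
noncomputable def chi (A : Set ℕ) : ℕ → ℕ := fun n => if n ∈ A then 1 else 0

/-- `A` is computably enumerable in (the characteristic function of) `X`. -/
def CEIn (X : Set ℕ) (A : Set ℕ) : Prop :=
  ∃ f : ℕ →. ℕ, PartrecIn (chi X) f ∧ ∀ n, n ∈ A ↔ (f n).Dom

/-- The `e`-th partial computable function `ℕ →. ℕ`. -/
def codeFn (e : ℕ) : ℕ →. ℕ := (Denumerable.ofNat Code e).eval

/-! ### Trees on ℕ -/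

def PrefixClosed (T : Set (List ℕ)) : Prop := ∀ l ∈ T, ∀ l' : List ℕ, l' <+: l → l' ∈ T

/-- Index `e` decides a (prefix-closed) tree on `ℕ`. -/
def DecidesTree (e : ℕ) : Prop :=
  (∀ n, (codeFn e n).Dom) ∧
    PrefixClosed {l : List ℕ | codeFn e (Encodable.encode l) = Part.some 1}

open Classical in
/-- The standard enumeration of computable trees on ℕ; indices that do not
decide a tree denote the empty tree. -/
noncomputable def treeAt (e : ℕ) : Set (List ℕ) :=
  if DecidesTree e then {l : List ℕ | codeFn e (Encodable.encode l) = Part.some 1} else ∅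

/-- `f` is a path through the tree `T`: every finite initial segment
`[f 0, …, f (k-1)]` is in `T`. -/
def IsPath (T : Set (List ℕ)) (f : ℕ → ℕ) : Prop := ∀ k, (List.range k).map f ∈ T

def IllFounded (T : Set (List ℕ)) : Prop := ∃ f, IsPath T f

/-- The set of indices of well-founded computable trees. -/
def WF : Set ℕ := {e | ¬ IllFounded (treeAt e)}

/-- `T` is a computable tree (prefix-closed and decided by a total computable function). -/
def ComputableTree (T : Set (List ℕ)) : Prop :=
  PrefixClosed T ∧ ∃ χ : List ℕ → Bool, Computable χ ∧ ∀ l, l ∈ T ↔ χ l = true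

/-! ### Highness notions for paths -/

def HighForPaths (X : Set ℕ) : Prop :=
  ∀ T : Set (List ℕ), ComputableTree T → IllFounded T →
    ∃ f : ℕ → ℕ, ComputableIn (chi X) f ∧ IsPath T f

def LoqHighForPaths (X : Set ℕ) : Prop :=
  ∃ F : ℕ × ℕ → ℕ, ComputableIn (chi X) F ∧
    ∀ e, IllFounded (treeAt e) → IsPath (treeAt e) fun n => F (e, n)

def UnifHighForPaths (X : Set ℕ) : Prop :=
  ∃ F : ℕ × ℕ →. ℕ, PartrecIn (chi X) F ∧
    ∀ e, IllFounded (treeAt e) →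
      ∃ g : ℕ → ℕ, IsPath (treeAt e) g ∧ ∀ n, F (e, n) = Part.some (g n)

def RetHighForPaths (X : Set ℕ) : Prop :=
  ∃ F : ℕ × ℕ →. ℕ, PartrecIn (chi X) F ∧
    (∀ e, IllFounded (treeAt e) →
      ∃ g : ℕ → ℕ, IsPath (treeAt e) g ∧ ∀ n, F (e, n) = Part.some (g n)) ∧
    (∀ e, ¬ IllFounded (treeAt e) → ∀ n, ¬ (F (e, n)).Dom)

/-! ### Σ¹₁ and Π¹₁ sets -/

def Sigma11 (A : Set ℕ) : Prop :=
  ∃ R : ℕ → List ℕ → Bool, Computable₂ R ∧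
    ∀ n, n ∈ A ↔ ∃ f : ℕ → ℕ, ∀ k, R n ((List.range k).map f) = true

def Pi11 (A : Set ℕ) : Prop := Sigma11 Aᶜ

/-! ### Linear orders -/

/-- A (presentation of a) linear order: a domain `D ⊆ ℕ` and a strict order
relation on it. -/
structure LinOrd where
  dom : Set ℕ
  lt : ℕ → ℕ → Prop

/-- `L` really is a strict linear order on its domain. -/
def LinOrd.IsValid (L : LinOrd) : Prop :=
  (∀ a b, L.lt a b → a ∈ L.dom ∧ b ∈ L.dom) ∧
  (∀ a, ¬ L.lt a a) ∧
  (∀ a b c, L.lt a b → L.lt b c → L.lt a c) ∧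
  (∀ a ∈ L.dom, ∀ b ∈ L.dom, a = b ∨ L.lt a b ∨ L.lt b a)

def linOrdOfCodes (n : ℕ) : LinOrd :=
  ⟨{a | codeFn n.unpair.1 a = Part.some 1},
   fun a b => codeFn n.unpair.2 (Nat.pair a b) = Part.some 1⟩

def DecidesLinOrd (n : ℕ) : Prop :=
  (∀ m, (codeFn n.unpair.1 m).Dom) ∧ (∀ m, (codeFn n.unpair.2 m).Dom) ∧
    (linOrdOfCodes n).IsValid

open Classical in
/-- The standard enumeration of computable linear orders; indices that do not
decide a linear order denote the empty order. -/
noncomputable def linOrdAt (n : ℕ) : LinOrd :=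
  if DecidesLinOrd n then linOrdOfCodes n else ⟨∅, fun _ _ => False⟩

def IsDescSeq (L : LinOrd) (f : ℕ → ℕ) : Prop :=
  ∀ i, f i ∈ L.dom ∧ L.lt (f (i + 1)) (f i)

def LinOrd.IllFounded (L : LinOrd) : Prop := ∃ f, IsDescSeq L f

/-- A tight descending sequence: a descending sequence that gets below every
descending sequence. -/
def IsTightDescSeq (L : LinOrd) (f : ℕ → ℕ) : Prop :=
  IsDescSeq L f ∧ ∀ g, IsDescSeq L g → ∀ n, ∃ m, L.lt (f m) (g n)

/-- `L` is a computable linear order. -/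
def ComputableLinOrd (L : LinOrd) : Prop :=
  L.IsValid ∧
  (∃ χ : ℕ → Bool, Computable χ ∧ ∀ a, a ∈ L.dom ↔ χ a = true) ∧
  (∃ χ : ℕ → ℕ → Bool, Computable₂ χ ∧ ∀ a b, L.lt a b ↔ χ a b = true)

def LoqHighForDS (X : Set ℕ) : Prop :=
  ∃ g : ℕ × ℕ → ℕ, ComputableIn (chi X) g ∧
    ∀ n, (linOrdAt n).IllFounded → IsDescSeq (linOrdAt n) fun k => g (n, k)

def HighForTightDS (X : Set ℕ) : Prop :=
  ∀ L : LinOrd, ComputableLinOrd L → L.IllFounded →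
    ∃ f : ℕ → ℕ, ComputableIn (chi X) f ∧ IsTightDescSeq L f

def UnifHighForTightDS (X : Set ℕ) : Prop :=
  ∃ F : ℕ × ℕ →. ℕ, PartrecIn (chi X) F ∧
    ∀ n, (linOrdAt n).IllFounded →
      ∃ g : ℕ → ℕ, IsTightDescSeq (linOrdAt n) g ∧ ∀ k, F (n, k) = Part.some (g k)

/-! ### Binary trees -/

def PrefixClosedB (B : Set (List Bool)) : Prop := ∀ l ∈ B, ∀ l' : List Bool, l' <+: l → l' ∈ B

def DecidesBTree (e : ℕ) : Prop :=
  (∀ n, (codeFn e n).Dom) ∧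
    PrefixClosedB {l : List Bool | codeFn e (Encodable.encode l) = Part.some 1}

open Classical in
/-- The standard enumeration of computable binary trees; indices that do not
decide a binary tree denote the full binary tree. -/
noncomputable def bTreeAt (e : ℕ) : Set (List Bool) :=
  if DecidesBTree e then {l : List Bool | codeFn e (Encodable.encode l) = Part.some 1}
  else Set.univ

def BInfinite (B : Set (List Bool)) : Prop := ∀ k, ∃ l ∈ B, l.length = k

def IsBPath (B : Set (List Bool)) (p : ℕ → Bool) : Prop := ∀ k, (List.range k).map p ∈ B


/-- `Y` is of PA degree over `X`: every infinite `X`-computable binary tree has a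
`Y`-computable infinite path. -/
def PAOver (Y X : Set ℕ) : Prop :=
  ∀ B : Set (List Bool), PrefixClosedB B →
    (∃ χ : List Bool → Bool, ComputableIn (chi X) χ ∧ ∀ l, l ∈ B ↔ χ l = true) →
    BInfinite B → ∃ p : ℕ → Bool, ComputableIn (chi Y) p ∧ IsBPath B p

/-! ### Closure properties of relative computability -/

section Relative

variable {O : ℕ → ℕ} {α β σ : Type} [Primcodable α] [Primcodable β] [Primcodable σ]

theorem RecursiveIn.of_partrec {f : ℕ →. ℕ} (hf : Nat.Partrec f) : RecursiveIn O f := by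
  induction hf with
  | zero => exact .zero
  | succ => exact .succ
  | left => exact .left
  | right => exact .right
  | pair _ _ hf hg => exact .pair hf hg
  | comp _ _ hf hg => exact .comp hf hg
  | prec _ _ hf hg => exact .prec hf hg
  | rfind _ hf => exact .rfind hf

theorem RecursiveIn.of_eq {f g : ℕ →. ℕ} (hf : RecursiveIn O f) (H : ∀ n, f n = g n) :
    RecursiveIn O g :=
  (funext H : f = g) ▸ hf

theorem ComputableIn.of_computable {f : α → σ} (hf : Computable f) : ComputableIn O f :=
  RecursiveIn.of_partrec hf

theorem ComputableIn.of_eq {f g : α → σ} (hf : ComputableIn O f) (H : ∀ a, f a = g a) :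
    ComputableIn O g :=
  (funext H : f = g) ▸ hf

theorem ComputableIn.comp {f : β → σ} {g : α → β} (hf : ComputableIn O f)
    (hg : ComputableIn O g) : ComputableIn O fun a => f (g a) :=
  (RecursiveIn.comp hf hg).of_eq fun n => by
    rcases e : Encodable.decode (α := α) n with - | a <;> simp [Encodable.encodek]

theorem ComputableIn.pair {f : α → β} {g : α → σ} (hf : ComputableIn O f)
    (hg : ComputableIn O g) : ComputableIn O fun a => (f a, g a) :=
  (RecursiveIn.pair hf hg).of_eq fun n => by
    rcases e : Encodable.decode (α := α) n with - | a <;> simp [Seq.seq]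

theorem ComputableIn.nat_rec {f : α → ℕ} {g : α → σ} {h : α × ℕ × σ → σ}
    (hf : ComputableIn O f) (hg : ComputableIn O g) (hh : ComputableIn O h) :
    ComputableIn O fun a =>
      Nat.rec (motive := fun _ => σ) (g a) (fun y IH => h (a, y, IH)) (f a) :=
  ((RecursiveIn.prec hg hh).comp (.pair (.of_partrec Nat.Partrec.some) hf)).of_eq fun n => by
    rcases e : Encodable.decode (α := α) n with - | a
    · simp [Seq.seq]
    · simp only [Seq.seq]
      simp
      induction f a <;> simp_all

/-- Unbounded search. -/
theorem ComputableIn.find {p : α × ℕ → Bool} (hp : ComputableIn O p)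
    (H : ∀ a, ∃ n, p (a, n) = true) : ComputableIn O fun a => Nat.find (H a) := by
  have hn : ComputableIn O fun x : α × ℕ => cond (p x) 0 1 :=
    (of_computable ((Primrec.dom_finite fun b : Bool => cond b 0 1).to_comp)).comp hp
  refine (RecursiveIn.rfind hn).of_eq fun n => ?_
  rcases e : Encodable.decode (α := α) n with - | a
  · simpa [e] using Nat.rfind_zero_none _ rfl
  · simp [e]
    refine Part.eq_some_iff.2 (Nat.mem_rfind.2 ⟨?_, ?_⟩)
    · simp [Nat.find_spec (H a)]
    · intro m hm
      simp [Nat.find_min (H a) hm]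

theorem ComputableIn.comp₂ {F : α × β → σ} {γ : Type} [Primcodable γ] {f : γ → α} {g : γ → β}
    (hF : Computable F) (hf : ComputableIn O f) (hg : ComputableIn O g) :
    ComputableIn O fun c => F (f c, g c) :=
  (of_computable hF).comp (hf.pair hg)

theorem computable_natPair : Computable fun x : ℕ × ℕ => Nat.pair x.1 x.2 :=
  Primrec.to_comp Primrec₂.natPair

theorem ComputableIn.natPair {f g : α → ℕ} (hf : ComputableIn O f) (hg : ComputableIn O g) :
    ComputableIn O fun a => Nat.pair (f a) (g a) :=
  ComputableIn.comp₂ computable_natPair hf hg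

theorem ComputableIn.not {p : α → Bool} (hp : ComputableIn O p) :
    ComputableIn O fun a => !p a :=
  (of_computable Primrec.not.to_comp).comp hp

theorem ComputableIn.and {p q : α → Bool} (hp : ComputableIn O p) (hq : ComputableIn O q) :
    ComputableIn O fun a => p a && q a :=
  comp₂ (F := fun x => x.1 && x.2) Primrec.and.to_comp hp hq

theorem ComputableIn.or {p q : α → Bool} (hp : ComputableIn O p) (hq : ComputableIn O q) :
    ComputableIn O fun a => p a || q a :=
  comp₂ (F := fun x => x.1 || x.2) Primrec.or.to_comp hp hq

/-- Bounded universal quantification. -/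
theorem ComputableIn.all_lt {p : α × ℕ → Bool} {f : α → ℕ} (hp : ComputableIn O p)
    (hf : ComputableIn O f) : ComputableIn O fun a => decide (∀ i < f a, p (a, i) = true) := by
  have hstep : ComputableIn O fun x : α × ℕ × Bool => x.2.2 && p (x.1, x.2.1) :=
    (of_computable (Computable.snd.comp Computable.snd)).and
      (hp.comp (of_computable (Computable.fst.pair (Computable.fst.comp Computable.snd))))
  refine (hf.nat_rec (of_computable (Computable.const true)) hstep).of_eq fun a => ?_
  induction f a with
  | zero => simp
  | succ k ih =>
    rw [Bool.eq_iff_iff]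
    simp only [ih, Nat.forall_lt_succ_right, Bool.and_eq_true, decide_eq_true_eq]

/-- Bounded existential quantification. -/
theorem ComputableIn.exists_lt {p : α × ℕ → Bool} {f : α → ℕ} (hp : ComputableIn O p)
    (hf : ComputableIn O f) : ComputableIn O fun a => decide (∃ i < f a, p (a, i) = true) :=
  (hp.not.all_lt hf).not.of_eq fun a => by
    rw [← decide_not]
    simp

end Relative

/-! ### The Kleene–Brouwer order -/

/-- The strict Kleene–Brouwer order on finite strings: a proper extension precedes the string it
extends, and incomparable strings are compared lexicographically. -/
def kb : List ℕ → List ℕ → Bool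
  | [], _ => false
  | _ :: _, [] => true
  | a :: l, b :: l' => decide (a < b) || (decide (a = b) && kb l l')

theorem kb_irrefl : ∀ l, kb l l = false
  | [] => rfl
  | a :: l => by simp [kb, kb_irrefl l]

theorem kb_trans : ∀ {l₁ l₂ l₃}, kb l₁ l₂ = true → kb l₂ l₃ = true → kb l₁ l₃ = true
  | [], _, _, h, _ => by simp [kb] at h
  | _ :: _, [], _, _, h => by simp [kb] at h
  | _ :: _, _ :: _, [], _, _ => rfl
  | a :: l₁, b :: l₂, c :: l₃, h, h' => by
    simp only [kb, Bool.or_eq_true, decide_eq_true_eq, Bool.and_eq_true] at *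
    rcases h with h | ⟨rfl, h⟩ <;> rcases h' with h' | ⟨rfl, h'⟩
    · exact .inl (h.trans h')
    · exact .inl h
    · exact .inl h'
    · exact .inr ⟨rfl, kb_trans h h'⟩

theorem kb_trichotomous : ∀ l l', l = l' ∨ kb l l' = true ∨ kb l' l = true
  | [], [] => .inl rfl
  | [], _ :: _ => .inr (.inr rfl)
  | _ :: _, [] => .inr (.inl rfl)
  | a :: l, b :: l' => by
    rcases lt_trichotomy a b with h | rfl | h
    · simp [kb, h]
    · rcases kb_trichotomous l l' with rfl | h | h <;> simp [kb, *]
    · simp [kb, h]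

theorem kb_append_singleton : ∀ (l : List ℕ) (a : ℕ), kb (l ++ [a]) l = true
  | [], _ => rfl
  | b :: l, a => by simp [kb, kb_append_singleton l a]

/-- One step of the comparison of a string with another one: the state consists of the unread part
of the second string (or `none` once the comparison is settled) and the current verdict. -/
def kbStep (s : Option (List ℕ) × Bool) (a : ℕ) : Option (List ℕ) × Bool :=
  Option.casesOn s.1 s fun r =>
    List.casesOn r (none, true) fun b r' =>
      if a < b then (none, true) else if a = b then (some r', false) else (none, false)

theorem foldl_kbStep_none (l : List ℕ) (b : Bool) : l.foldl kbStep (none, b) = (none, b) := by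
  induction l with
  | nil => rfl
  | cons a l ih => exact ih

theorem foldl_kbStep : ∀ l l' : List ℕ, (l.foldl kbStep (some l', false)).2 = kb l l'
  | [], _ => rfl
  | a :: l, [] => by simp [kbStep, kb, foldl_kbStep_none]
  | a :: l, b :: l' => by
    rcases lt_trichotomy a b with h | rfl | h
    · simp [kbStep, kb, foldl_kbStep_none, h]
    · simp [kbStep, kb, foldl_kbStep l l']
    · simp [kbStep, kb, foldl_kbStep_none, h.not_gt, h.ne']

theorem primrec_kbStep : Primrec₂ kbStep := by
  have hb : Primrec fun x : (((Option (List ℕ) × Bool) × ℕ) × List ℕ) × ℕ × List ℕ => x.2.1 :=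
    Primrec.fst.comp Primrec.snd
  have ha : Primrec fun x : (((Option (List ℕ) × Bool) × ℕ) × List ℕ) × ℕ × List ℕ => x.1.1.2 :=
    Primrec.snd.comp (Primrec.fst.comp Primrec.fst)
  have hcons : Primrec₂ fun (x : ((Option (List ℕ) × Bool) × ℕ) × List ℕ) (y : ℕ × List ℕ) =>
      if x.1.2 < y.1 then ((none, true) : Option (List ℕ) × Bool)
      else if x.1.2 = y.1 then (some y.2, false) else (none, false) :=
    Primrec.ite (Primrec.nat_lt.comp ha hb) (Primrec.const _)
      (Primrec.ite (Primrec.eq.comp ha hb)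
        ((Primrec.option_some.comp (Primrec.snd.comp Primrec.snd)).pair (Primrec.const _))
        (Primrec.const _))
  exact Primrec.option_casesOn (Primrec.fst.comp Primrec.fst) Primrec.fst
    (Primrec.list_casesOn Primrec.snd (Primrec.const _) hcons)

theorem primrec_kb : Primrec₂ kb :=
  (Primrec.snd.comp (Primrec.list_foldl Primrec.fst
    ((Primrec.option_some.comp Primrec.snd).pair (Primrec.const false))
    (primrec_kbStep.comp (Primrec.fst.comp Primrec.snd) (Primrec.snd.comp Primrec.snd)).to₂)).of_eq
    fun x => foldl_kbStep x.1 x.2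

open Denumerable (ofNat)

/-- The Kleene–Brouwer order on the part of the tree `T` above the node `σ`. -/
def kbOrd (T : Set (List ℕ)) (σ : List ℕ) : LinOrd :=
  ⟨{a | σ ++ ofNat (List ℕ) a ∈ T},
    fun a b => σ ++ ofNat (List ℕ) a ∈ T ∧ σ ++ ofNat (List ℕ) b ∈ T ∧
      kb (ofNat (List ℕ) a) (ofNat (List ℕ) b) = true⟩

theorem kbOrd_isValid (T : Set (List ℕ)) (σ : List ℕ) : (kbOrd T σ).IsValid := by
  refine ⟨fun a b h => ⟨h.1, h.2.1⟩, fun a h => ?_, fun a b c h h' => ?_, fun a ha b hb => ?_⟩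
  · simp [kbOrd, kb_irrefl] at h
  · exact ⟨h.1, h'.2.1, kb_trans h.2.2 h'.2.2⟩
  · rcases kb_trichotomous (ofNat (List ℕ) a) (ofNat (List ℕ) b) with h | h | h
    · exact .inl (by simpa using congrArg Encodable.encode h)
    · exact .inr (.inl ⟨ha, hb, h⟩)
    · exact .inr (.inr ⟨hb, ha, h⟩)

theorem kbOrd_illFounded_nil {T : Set (List ℕ)} (hT : IllFounded T) :
    (kbOrd T []).IllFounded := by
  obtain ⟨f, hf⟩ := hT
  refine ⟨fun k => Encodable.encode ((List.range k).map f), fun k => ⟨?_, ?_, ?_, ?_⟩⟩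
  · simpa [kbOrd] using hf k
  · simpa using hf (k + 1)
  · simpa using hf k
  · simpa [List.range_succ] using kb_append_singleton ((List.range k).map f) (f k)

theorem mem_of_kbOrd_illFounded {T : Set (List ℕ)} (hT : PrefixClosed T) {σ : List ℕ}
    (h : (kbOrd T σ).IllFounded) : σ ∈ T := by
  obtain ⟨f, hf⟩ := h
  exact hT _ (hf 0).1 _ (List.prefix_append _ _)

/-- A descending sequence above `σ` bounds a child of `σ` with a descending sequence above it. -/
theorem exists_child_kbOrd_illFounded {T : Set (List ℕ)} {σ : List ℕ} {f : ℕ → ℕ}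
    (hf : IsDescSeq (kbOrd T σ) f) :
    ∃ i ≤ (ofNat (List ℕ) (f 1)).headI, (kbOrd T (σ ++ [i])).IllFounded := by
  have hlt : ∀ k, kb (ofNat (List ℕ) (f (k + 1))) (ofNat (List ℕ) (f k)) = true :=
    fun k => (hf k).2.2.2
  have hcons : ∀ k, ofNat (List ℕ) (f (k + 1)) =
      (ofNat (List ℕ) (f (k + 1))).headI :: (ofNat (List ℕ) (f (k + 1))).tail := by
    intro k
    have := hlt k
    generalize ofNat (List ℕ) (f (k + 1)) = l at *
    cases l with
    | nil => simp [kb] at this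
    | cons a l => rfl
  set c : ℕ → ℕ := fun k => (ofNat (List ℕ) (f (k + 1))).headI with hc
  have hanti : Antitone c := by
    refine antitone_nat_of_succ_le fun k => ?_
    have := hlt (k + 1)
    rw [hcons k, hcons (k + 1)] at this
    simp only [kb, Bool.or_eq_true, decide_eq_true_eq, Bool.and_eq_true] at this
    rcases this with h | h
    · exact h.le
    · exact h.1.le
  obtain ⟨N, hN⟩ := WellFoundedGT.monotone_chain_condition
    (⟨fun k => OrderDual.toDual (c k), hanti⟩ : ℕ →o ℕᵒᵈ)
  have hN' : ∀ k, N ≤ k → c k = c N := fun k hk => (congrArg OrderDual.ofDual (hN k hk)).symm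
  have hshape : ∀ k, ofNat (List ℕ) (f (N + k + 1)) =
      c N :: (ofNat (List ℕ) (f (N + k + 1))).tail := fun k => by
    rw [← hN' (N + k) (by omega)]
    exact hcons (N + k)
  have hmem : ∀ k, σ ++ [c N] ++ (ofNat (List ℕ) (f (N + k + 1))).tail ∈ T := fun k => by
    have := (hf (N + k + 1)).1
    simp only [kbOrd, Set.mem_ofPred_eq] at this
    rw [hshape k] at this
    simpa using this
  refine ⟨c N, hanti (Nat.zero_le N),
    fun k => Encodable.encode (ofNat (List ℕ) (f (N + k + 1))).tail, fun k => ⟨?_, ?_, ?_, ?_⟩⟩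
  · simpa [kbOrd] using hmem k
  · simpa using hmem (k + 1)
  · simpa using hmem k
  · have := hlt (N + k + 1)
    rw [hshape k] at this
    erw [hshape (k + 1)] at this
    simpa [kb] using this

/-! ### Indices of Kleene–Brouwer orders -/

/-- Membership of the `a`-th string above the node `σ` in the tree with index `e`, where `x` codes
the pair of `e` and `σ`. -/
def subtreeFn (x a : ℕ) : Part ℕ :=
  codeFn x.unpair.1 (Encodable.encode (ofNat (List ℕ) x.unpair.2 ++ ofNat (List ℕ) a))

/-- The Kleene–Brouwer comparison of the `a`-th and `b`-th strings above the node `σ` in the tree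
with index `e`, where `x` codes the pair of `e` and `σ`. -/
def subtreeLtFn (x a b : ℕ) : Part ℕ :=
  (subtreeFn x a).bind fun u => (subtreeFn x b).map fun v =>
    if u = 1 ∧ v = 1 ∧ kb (ofNat (List ℕ) a) (ofNat (List ℕ) b) = true then 1 else 0

theorem partrec₂_subtreeFn : Partrec₂ subtreeFn := by
  have hu := Primrec.unpair.comp (Primrec.fst (α := ℕ) (β := ℕ))
  have h1 : Primrec fun p : ℕ × ℕ => ofNat Code p.1.unpair.1 :=
    (Primrec.ofNat Code).comp (Primrec.fst.comp hu)
  have h2 : Primrec fun p : ℕ × ℕ =>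
      Encodable.encode (ofNat (List ℕ) p.1.unpair.2 ++ ofNat (List ℕ) p.2) :=
    Primrec.encode.comp (Primrec.list_append.comp
      ((Primrec.ofNat (List ℕ)).comp (Primrec.snd.comp hu))
      ((Primrec.ofNat (List ℕ)).comp Primrec.snd))
  exact Code.eval_part.comp h1.to_comp h2.to_comp

theorem partrec_subtreeLtFn :
    Partrec fun p : ℕ × ℕ × ℕ => subtreeLtFn p.1 p.2.1 p.2.2 := by
  have ha : Primrec fun q : ((ℕ × ℕ × ℕ) × ℕ) × ℕ => ofNat (List ℕ) q.1.1.2.1 :=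
    (Primrec.ofNat (List ℕ)).comp (Primrec.fst.comp (Primrec.snd.comp
      (Primrec.fst.comp Primrec.fst)))
  have hb : Primrec fun q : ((ℕ × ℕ × ℕ) × ℕ) × ℕ => ofNat (List ℕ) q.1.1.2.2 :=
    (Primrec.ofNat (List ℕ)).comp (Primrec.snd.comp (Primrec.snd.comp
      (Primrec.fst.comp Primrec.fst)))
  have hv : Primrec fun q : ((ℕ × ℕ × ℕ) × ℕ) × ℕ =>
      if q.1.2 = 1 ∧ q.2 = 1 ∧ kb (ofNat (List ℕ) q.1.1.2.1) (ofNat (List ℕ) q.1.1.2.2) = true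
        then 1 else 0 :=
    Primrec.ite
      ((Primrec.eq.comp (Primrec.snd.comp Primrec.fst) (Primrec.const 1)).and
        ((Primrec.eq.comp Primrec.snd (Primrec.const 1)).and
          (Primrec.eq.comp (primrec_kb.comp ha hb) (Primrec.const true))))
      (Primrec.const 1) (Primrec.const 0)
  refine Partrec.bind (g := fun (p : ℕ × ℕ × ℕ) (u : ℕ) => (subtreeFn p.1 p.2.2).map fun v =>
    if u = 1 ∧ v = 1 ∧ kb (ofNat (List ℕ) p.2.1) (ofNat (List ℕ) p.2.2) = true then 1 else 0)
    (partrec₂_subtreeFn.comp Computable.fst (Computable.fst.comp Computable.snd)) ?_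
  exact Partrec.map
    (partrec₂_subtreeFn.comp (Computable.fst.comp Computable.fst)
      (Computable.snd.comp (Computable.snd.comp Computable.fst))) hv.to_comp

/-- The s-m-n theorem in terms of indices. -/
theorem exists_computable_index {f : ℕ → ℕ →. ℕ} (hf : Partrec₂ f) :
    ∃ m : ℕ → ℕ, Computable m ∧ ∀ x, codeFn (m x) = f x := by
  obtain ⟨c, hc⟩ := Code.exists_code.1 (Partrec.nat_iff.1 (Partrec₂.unpaired.2 hf))
  refine ⟨fun x => Encodable.encode (c.curry x), ?_, fun x => ?_⟩
  · exact (Primrec.encode.comp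
      (Code.primrec₂_curry.comp (Primrec.const c) Primrec.id)).to_comp
  · funext n
    simp [codeFn, Code.eval_curry, hc]

theorem mem_treeAt {e : ℕ} (he : DecidesTree e) (l : List ℕ) :
    l ∈ treeAt e ↔ codeFn e (Encodable.encode l) = Part.some 1 := by
  rw [treeAt, if_pos he]
  rfl

/-- Indices of the Kleene–Brouwer orders above nodes of computable trees are found uniformly. -/
theorem exists_kbIndex : ∃ m : ℕ → ℕ, Computable m ∧ ∀ e, DecidesTree e → ∀ σ : List ℕ,
    DecidesLinOrd (m (Nat.pair e (Encodable.encode σ))) ∧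
      linOrdAt (m (Nat.pair e (Encodable.encode σ))) = kbOrd (treeAt e) σ := by
  obtain ⟨d, hd, hdom⟩ := exists_computable_index partrec₂_subtreeFn
  have hltFn := partrec_subtreeLtFn.comp
    ((Computable.fst (α := ℕ) (β := ℕ)).pair (Computable.unpair.comp Computable.snd))
  obtain ⟨r, hr, hlt⟩ := exists_computable_index
    (f := fun x n => subtreeLtFn x n.unpair.1 n.unpair.2) hltFn
  refine ⟨fun x => Nat.pair (d x) (r x), computable_natPair.comp (hd.pair hr),
    fun e he σ => ?_⟩
  generalize hx : Nat.pair e (Encodable.encode σ) = x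
  have hx1 : x.unpair.1 = e := by rw [← hx, Nat.unpair_pair]
  have hx2 : x.unpair.2 = Encodable.encode σ := by rw [← hx, Nat.unpair_pair]
  have hdom' : ∀ a, (subtreeFn x a).Dom := fun a => by
    rw [subtreeFn, hx1]
    exact he.1 _
  have hmem : ∀ a, σ ++ ofNat (List ℕ) a ∈ treeAt e ↔ subtreeFn x a = Part.some 1 := fun a => by
    rw [mem_treeAt he]
    simp [subtreeFn, hx1, hx2]
  have hord : linOrdOfCodes (Nat.pair (d x) (r x)) = kbOrd (treeAt e) σ := by
    simp only [linOrdOfCodes, kbOrd, Nat.unpair_pair, hdom, hlt, hmem]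
    congr
    funext a b
    obtain ⟨u, hu⟩ := Part.dom_iff_mem.1 (hdom' a)
    obtain ⟨v, hv⟩ := Part.dom_iff_mem.1 (hdom' b)
    rw [← Part.eq_some_iff] at hu hv
    simp [subtreeLtFn, hu, hv]
  have hdec : DecidesLinOrd (Nat.pair (d x) (r x)) := by
    refine ⟨fun a => ?_, fun n => ?_, hord ▸ kbOrd_isValid _ _⟩
    · simpa [hdom] using hdom' a
    · simpa [hlt, subtreeLtFn] using ⟨hdom' _, hdom' _⟩
  exact ⟨hdec, by rw [linOrdAt, if_pos hdec, hord]⟩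

/-! ### Refuting a descending sequence -/

/-- Within `s` steps the computation of the `e`-th function at `n` yields a value other than `1`. -/
def refutes (e n s : ℕ) : Bool := Option.casesOn (Code.evaln s (ofNat Code e) n) false (· != 1)

theorem computable_refutes : Computable fun p : (ℕ × ℕ) × ℕ => refutes p.1.1 p.1.2 p.2 := by
  refine Primrec.to_comp (Primrec.option_casesOn (Code.primrec_evaln.comp
    ((Primrec.snd.pair ((Primrec.ofNat Code).comp (Primrec.fst.comp Primrec.fst))).pair
      (Primrec.snd.comp Primrec.fst))) (Primrec.const false) ?_)
  exact (Primrec.not.comp (Primrec.beq.comp Primrec.snd (Primrec.const 1)))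

theorem exists_refutes_iff {e n : ℕ} (h : (codeFn e n).Dom) :
    (∃ s, refutes e n s = true) ↔ codeFn e n ≠ Part.some 1 := by
  obtain ⟨v, hv⟩ := Part.dom_iff_mem.1 h
  constructor
  · rintro ⟨s, hs⟩ h1
    rcases hw : Code.evaln s (ofNat Code e) n with - | w
    · simp [refutes, hw] at hs
    · have := Code.evaln_sound hw
      simp only [codeFn] at h1
      rw [h1, Part.mem_some_iff] at this
      simp [refutes, hw, this] at hs
  · intro h1
    obtain ⟨s, hs⟩ := Code.evaln_complete.1 hv
    refine ⟨s, ?_⟩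
    rw [Option.mem_def] at hs
    have : v ≠ 1 := by
      rintro rfl
      exact h1 (Part.eq_some_iff.2 hv)
    simp [refutes, hs, this]

/-- If `X` is loquaciously high for descending sequences, then well-foundedness of computable
linear orders is c.e. in `X`. -/
theorem exists_refutation {X : Set ℕ} {g : ℕ × ℕ → ℕ} (hg : ComputableIn (chi X) g)
    (hds : ∀ n, (linOrdAt n).IllFounded → IsDescSeq (linOrdAt n) fun k => g (n, k)) :
    ∃ bad : ℕ × ℕ → Bool, ComputableIn (chi X) bad ∧
      ∀ m, DecidesLinOrd m → ((linOrdAt m).IllFounded ↔ ∀ u, bad (m, u) = false) := by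
  refine ⟨fun p =>
    refutes p.1.unpair.1 (g (p.1, p.2.unpair.1)) p.2.unpair.2 ||
      refutes p.1.unpair.2 (Nat.pair (g (p.1, p.2.unpair.1 + 1)) (g (p.1, p.2.unpair.1)))
        p.2.unpair.2, ?_, fun m hm => ?_⟩
  · have hi : Computable fun p : ℕ × ℕ => p.1.unpair := Computable.unpair.comp Computable.fst
    have hu : Computable fun p : ℕ × ℕ => p.2.unpair := Computable.unpair.comp Computable.snd
    have hg0 : ComputableIn (chi X) fun p : ℕ × ℕ => g (p.1, p.2.unpair.1) :=
      hg.comp (.of_computable (Computable.fst.pair (Computable.fst.comp hu)))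
    have hg1 : ComputableIn (chi X) fun p : ℕ × ℕ => g (p.1, p.2.unpair.1 + 1) :=
      hg.comp (.of_computable (Computable.fst.pair
        (Computable.succ.comp (Computable.fst.comp hu))))
    have hs := ComputableIn.of_computable (O := chi X) (Computable.snd.comp hu)
    have href := ComputableIn.of_computable (O := chi X) computable_refutes
    have hd := ((ComputableIn.of_computable (O := chi X) (Computable.fst.comp hi)).pair hg0).pair hs
    have hl := ((ComputableIn.of_computable (O := chi X) (Computable.snd.comp hi)).pair
      (hg1.natPair hg0)).pair hs
    have h1 := href.comp hd
    have h2 := href.comp hl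
    exact h1.or h2
  · have hL : linOrdAt m = linOrdOfCodes m := if_pos hm
    have key : IsDescSeq (linOrdAt m) (fun k => g (m, k)) ↔ ∀ k s,
        refutes m.unpair.1 (g (m, k)) s = false ∧
          refutes m.unpair.2 (Nat.pair (g (m, k + 1)) (g (m, k))) s = false := by
      rw [hL]
      refine forall_congr' fun k => ?_
      have h1 := exists_refutes_iff (hm.1 (g (m, k)))
      have h2 := exists_refutes_iff (hm.2.1 (Nat.pair (g (m, k + 1)) (g (m, k))))
      rw [forall_and]
      refine and_congr ?_ ?_
      · simpa [linOrdOfCodes] using (not_congr h1).symm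
      · simpa [linOrdOfCodes] using (not_congr h2).symm
    rw [show (linOrdAt m).IllFounded ↔ IsDescSeq (linOrdAt m) (fun k => g (m, k)) from
      ⟨hds m, fun h => ⟨_, h⟩⟩, key]
    constructor
    · intro h u
      simp [h]
    · intro h k s
      simpa using h (Nat.pair k s)

/-! ### Using PA degrees -/

/-- A degree that is PA over `X` separates disjoint sets that are c.e. in `X`. -/
theorem PAOver.exists_separation {X Y : Set ℕ} (hY : PAOver Y X) {A B : ℕ × ℕ → Bool}
    (hA : ComputableIn (chi X) A) (hB : ComputableIn (chi X) B)
    (hAB : ∀ x n n', A (x, n) = true → B (x, n') = false) :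
    ∃ p : ℕ → Bool, ComputableIn (chi Y) p ∧
      ∀ x n, (A (x, n) = true → p x = true) ∧ (B (x, n) = true → p x = false) := by
  let ok : (List Bool × ℕ) × ℕ → Bool := fun q =>
    (!A (q.1.2, q.2) || decide (q.1.1[q.1.2]? = some true)) &&
      (!B (q.1.2, q.2) || decide (q.1.1[q.1.2]? = some false))
  let χ : List Bool → Bool := fun l =>
    decide (∀ x < l.length, decide (∀ n < l.length, ok ((l, x), n) = true) = true)
  have hok : ComputableIn (chi X) ok := by
    have hxn : Computable fun q : (List Bool × ℕ) × ℕ => (q.1.2, q.2) :=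
      (Computable.snd.comp Computable.fst).pair Computable.snd
    have hget : Primrec fun q : (List Bool × ℕ) × ℕ => q.1.1[q.1.2]? :=
      Primrec.list_getElem?.comp (Primrec.fst.comp Primrec.fst) (Primrec.snd.comp Primrec.fst)
    have heq (b : Bool) : ComputableIn (chi X) fun q : (List Bool × ℕ) × ℕ =>
        decide (q.1.1[q.1.2]? = some b) := by
      have hb := Primrec.eq.decide.comp hget (Primrec.const (some b))
      exact .of_computable hb.to_comp
    have hA' := hA.comp (.of_computable hxn)
    have hB' := hB.comp (.of_computable hxn)
    have hA'' := hA'.not.or (heq true)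
    have hB'' := hB'.not.or (heq false)
    exact hA''.and hB''
  have hχ : ComputableIn (chi X) χ := by
    have hin := hok.all_lt (f := fun q : List Bool × ℕ => q.1.length)
      (.of_computable (Computable.list_length.comp Computable.fst))
    exact hin.all_lt (.of_computable Computable.list_length)
  have hχ_iff (l : List Bool) : χ l = true ↔ ∀ x < l.length, ∀ n < l.length,
      (A (x, n) = true → l[x]? = some true) ∧ (B (x, n) = true → l[x]? = some false) := by
    simp only [χ, ok, decide_eq_true_eq, Bool.and_eq_true, Bool.or_eq_true, Bool.not_eq_true',
      ← Bool.not_eq_true, imp_iff_not_or]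
  have hclosed : PrefixClosedB {l | χ l = true} := by
    rintro l hl _ ⟨t, rfl⟩
    refine (hχ_iff _).2 fun x hx n hn => ?_
    have h := (hχ_iff _).1 hl x (by simp; omega) n (by simp; omega)
    rwa [List.getElem?_append_left hx] at h
  have hinf : BInfinite {l | χ l = true} := by
    classical
    intro k
    refine ⟨(List.range k).map fun x => decide (∃ n, A (x, n) = true), (hχ_iff _).2 ?_, by simp⟩
    intro x hx n hn
    have hx' : x < k := by simpa using hx
    simp only [List.getElem?_map, List.getElem?_range hx', Option.map_some, Option.some.injEq,
      decide_eq_true_eq, decide_eq_false_iff_not]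
    refine ⟨fun h => ⟨n, h⟩, ?_⟩
    rintro h ⟨n', h'⟩
    simp [hAB x n' n h'] at h
  obtain ⟨p, hp, hpath⟩ := hY _ hclosed ⟨χ, hχ, fun _ => Iff.rfl⟩ hinf
  refine ⟨p, hp, fun x n => ?_⟩
  have h := (hχ_iff _).1 (hpath (max x n + 1)) x (by simp) n (by simp)
  have hx : x < max x n + 1 := by omega
  simpa [hx] using h

/-- A degree that is PA over `X` uniformly selects, below an `X`-computable bound, elements of
sets that are co-c.e. in `X`. -/
theorem PAOver.exists_selection {X Y : Set ℕ} (hY : PAOver Y X) {bad : (ℕ × ℕ) × ℕ → Bool}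
    {h : ℕ → ℕ} (hbad : ComputableIn (chi X) bad) (hh : ComputableIn (chi X) h) :
    ∃ s : ℕ → ℕ, ComputableIn (chi Y) s ∧
      ∀ x, (∃ i ≤ h x, ∀ n, bad ((x, i), n) = false) → ∀ n, bad ((x, s x), n) = false := by
  let R : (ℕ × ℕ) × ℕ → Bool := fun q => decide (∃ n < q.2, bad (q.1, n) = true)
  let S : (ℕ × ℕ) × ℕ → Bool := fun q =>
    decide (∀ j < h q.1.1 + 1, (decide (j ≤ q.1.2) || R ((q.1.1, j), q.2)) = true)
  have hS_iff (x i n) : S ((x, i), n) = true ↔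
      ∀ j ≤ h x, i < j → ∃ n' < n, bad ((x, j), n') = true := by
    simp only [S, R, decide_eq_true_eq, Bool.or_eq_true, Nat.lt_succ_iff, ← not_lt (a := i),
      ← imp_iff_not_or]
  have hR_iff (x i n) : R ((x, i), n) = true ↔ ∃ n' < n, bad ((x, i), n') = true := by
    simp only [R, decide_eq_true_eq]
  have hR : ComputableIn (chi X) R := by
    have hb : ComputableIn (chi X) fun q : ((ℕ × ℕ) × ℕ) × ℕ => bad (q.1.1, q.2) :=
      hbad.comp (.of_computable ((Computable.fst.comp Computable.fst).pair Computable.snd))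
    exact hb.exists_lt (.of_computable Computable.snd)
  have hS : ComputableIn (chi X) S := by
    have hx : Computable fun q : ((ℕ × ℕ) × ℕ) × ℕ => q.1.1 := Computable.fst.comp Computable.fst
    have hle : ComputableIn (chi X) fun q : ((ℕ × ℕ) × ℕ) × ℕ => decide (q.2 ≤ q.1.1.2) :=
      .of_computable (Primrec.nat_le.decide.comp Primrec.snd
        (Primrec.snd.comp (Primrec.fst.comp Primrec.fst))).to_comp
    have hRj := hR.comp (.of_computable (((Computable.fst.comp hx).pair Computable.snd).pair
      (Computable.snd.comp Computable.fst)))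
    have hb : ComputableIn (chi X) fun q : (ℕ × ℕ) × ℕ => h q.1.1 + 1 :=
      (ComputableIn.of_computable Computable.succ).comp
        (hh.comp (.of_computable (Computable.fst.comp Computable.fst)))
    exact (hle.or hRj).all_lt hb
  have hcode : ComputableIn (chi X) fun q : ℕ × ℕ => (q.1.unpair, q.2) :=
    .of_computable ((Computable.unpair.comp Computable.fst).pair Computable.snd)
  have hS' := hS.comp hcode
  have hR' := hR.comp hcode
  obtain ⟨p, hp, hsep⟩ := hY.exists_separation (hS'.and hR'.not) (hR'.and hS'.not) <| by
    intro x n n'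
    rw [Bool.and_eq_true, Bool.not_eq_true', Bool.and_eq_false_iff, Bool.not_eq_false',
      ← Bool.not_eq_true, ← Bool.not_eq_true]
    rintro ⟨hs, hr⟩
    rw [hS_iff] at hs ⊢
    rw [hR_iff] at hr ⊢
    rcases le_total n n' with hn | hn
    · refine .inr fun j hj hij => ?_
      obtain ⟨k, hk, hk'⟩ := hs j hj hij
      exact ⟨k, hk.trans_le hn, hk'⟩
    · refine .inl fun ⟨k, hk, hk'⟩ => hr ⟨k, hk.trans_le hn, hk'⟩
  have htrue {x i n} (hs : S ((x, i), n) = true) (hr : ¬ R ((x, i), n) = true) :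
      p (Nat.pair x i) = true :=
    (hsep (Nat.pair x i) n).1 (by simp [hs, hr])
  have hfalse {x i n} (hs : ¬ S ((x, i), n) = true) (hr : R ((x, i), n) = true) :
      p (Nat.pair x i) = false :=
    (hsep (Nat.pair x i) n).2 (by simp [hs, hr])
  have hex (x : ℕ) : ∃ i, p (Nat.pair x i) = true :=
    ⟨h x, htrue (n := 0) ((hS_iff _ _ _).2 fun j hj hij => absurd hij hj.not_gt)
      (by simp [hR_iff])⟩
  have hpp : ComputableIn (chi Y) fun q : ℕ × ℕ => p (Nat.pair q.1 q.2) :=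
    hp.comp (.of_computable computable_natPair)
  refine ⟨fun x => Nat.find (hex x), hpp.find hex, fun x hx => ?_⟩
  have hlive : ∀ i ≤ Nat.find (hex x), ∃ j ≤ h x, i ≤ j ∧ ∀ n, bad ((x, j), n) = false := by
    intro i
    induction i with
    | zero => exact fun _ => hx.imp fun j hj => ⟨hj.1, j.zero_le, hj.2⟩
    | succ i ih =>
      intro hi
      by_contra! hno
      obtain ⟨j, hj, hij, hgood⟩ := ih (by omega)
      have hji : j = i := by
        by_contra hne
        obtain ⟨n, hn⟩ := hno j hj (by omega)
        exact hn (hgood n)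
      subst hji
      choose! t ht using hno
      obtain ⟨N, hN⟩ := ((Finset.range (h x + 1)).image t).bddAbove
      refine Nat.find_min (hex x) hi (htrue (n := N + 1) ((hS_iff _ _ _).2 fun k hk hjk => ?_) ?_)
      · refine ⟨t k, Nat.lt_succ_of_le (hN ?_), by simpa using ht k hk hjk⟩
        exact Finset.mem_coe.2 (Finset.mem_image_of_mem _ (Finset.mem_range.2 (by omega)))
      · simp [hR_iff, hgood]
  by_contra! hbad'
  obtain ⟨n, hn⟩ := hbad'
  obtain ⟨j, hj, hij, hgood⟩ := hlive _ le_rfl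
  have hne : Nat.find (hex x) ≠ j := by
    rintro heq
    exact hn (heq ▸ hgood n)
  have hf := hfalse (x := x) (i := Nat.find (hex x)) (n := n + 1)
    (fun hs => by
      obtain ⟨k, -, hk⟩ := (hS_iff _ _ _).1 hs j hj (lt_of_le_of_ne hij hne)
      simp [hgood] at hk)
    ((hR_iff _ _ _).2 ⟨n, n.lt_succ_self, by simpa using hn⟩)
  simp [Nat.find_spec (hex x)] at hf

/-- The string of length `n` obtained by iterating the selection of a child by `s`, for the tree
with index `e`. -/
def selectedString (s : ℕ → ℕ) (e : ℕ) : ℕ → List ℕ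
  | 0 => []
  | n + 1 => selectedString s e n ++ [s (Nat.pair e (Encodable.encode (selectedString s e n)))]

theorem selectedString_eq_map (s : ℕ → ℕ) (e n : ℕ) :
    selectedString s e n = (List.range n).map
      fun k => s (Nat.pair e (Encodable.encode (selectedString s e k))) := by
  induction n with
  | zero => rfl
  | succ n ih => rw [List.range_succ, List.map_append, ← ih]; rfl

theorem ComputableIn.selectedString {O s : ℕ → ℕ} (hs : ComputableIn O s) :
    ComputableIn O fun q : ℕ × ℕ =>
      s (Nat.pair q.1 (Encodable.encode (selectedString s q.1 q.2))) := by
  have hrec : ComputableIn O fun q : ℕ × ℕ => CFT.selectedString s q.1 q.2 := by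
    have hl : Computable fun q : (ℕ × ℕ) × ℕ × List ℕ => q.2.2 :=
      Computable.snd.comp Computable.snd
    have hchild := hs.comp ((of_computable (O := O)
      (Computable.fst.comp (Computable.fst (α := ℕ × ℕ) (β := ℕ × List ℕ)))).natPair
        (of_computable (Computable.encode.comp hl)))
    have hstep := comp₂ (F := fun x : List ℕ × ℕ => x.1 ++ [x.2])
      (Primrec.to_comp Primrec.list_concat) (of_computable hl) hchild
    have hiter := (of_computable Computable.snd).nat_rec
      (of_computable (Computable.const [])) hstep
    refine hiter.of_eq fun q => ?_
    induction q.2 with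
    | zero => rfl
    | succ n ih => simp only [ih, CFT.selectedString]
  have hnode := (of_computable (O := O) (Computable.fst (α := ℕ) (β := ℕ))).natPair
    ((of_computable Computable.encode).comp hrec)
  exact hs.comp hnode

/-- If `X` is loquaciously high for descending sequences and `Y` is of PA
degree over `X`, then `Y` is loquaciously high for paths. -/
theorem pa_over_loqHighForDS_is_loqHighForPaths (X Y : Set ℕ)
    (hX : LoqHighForDS X) (hY : PAOver Y X) : LoqHighForPaths Y := by
  obtain ⟨g, hg, hds⟩ := hX
  obtain ⟨bad, hbad, hbad_iff⟩ := exists_refutation hg hds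
  obtain ⟨m, hm, hkb⟩ := exists_kbIndex
  let child : ℕ × ℕ → ℕ := fun q =>
    Nat.pair q.1.unpair.1 (Encodable.encode (ofNat (List ℕ) q.1.unpair.2 ++ [q.2]))
  have hchild : Computable child := by
    have hu : Primrec fun q : ℕ × ℕ => q.1.unpair := Primrec.unpair.comp Primrec.fst
    have hl : Primrec fun q : ℕ × ℕ =>
        Encodable.encode (ofNat (List ℕ) q.1.unpair.2 ++ [q.2]) :=
      Primrec.encode.comp (Primrec.list_concat.comp
        ((Primrec.ofNat (List ℕ)).comp (Primrec.snd.comp hu)) Primrec.snd)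
    have hp := (Primrec.fst.comp hu).pair hl
    have hpair := computable_natPair.comp hp.to_comp
    exact hpair
  have hbadChild : ComputableIn (chi X) fun q : (ℕ × ℕ) × ℕ => bad (m (child q.1), q.2) :=
    hbad.comp (.of_computable ((hm.comp (hchild.comp Computable.fst)).pair Computable.snd))
  have hbound : ComputableIn (chi X) fun x => (ofNat (List ℕ) (g (m x, 1))).headI := by
    have hg1 := hg.comp (.of_computable (hm.pair (Computable.const 1)))
    have hhead : Primrec fun a => (ofNat (List ℕ) a).headI :=
      Primrec.list_headI.comp (Primrec.ofNat (List ℕ))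
    exact (ComputableIn.of_computable hhead.to_comp).comp hg1
  obtain ⟨s, hs, hsel⟩ := hY.exists_selection hbadChild hbound
  refine ⟨_, hs.selectedString, fun e he => ?_⟩
  have hdec : DecidesTree e := by
    by_contra hno
    obtain ⟨f, hf⟩ := he
    simpa [treeAt, hno] using hf 0
  have hpc : PrefixClosed (treeAt e) := by
    rw [treeAt, if_pos hdec]
    exact hdec.2
  have hgood : ∀ n, (kbOrd (treeAt e) (selectedString s e n)).IllFounded := by
    intro n
    induction n with
    | zero => exact kbOrd_illFounded_nil he
    | succ n ih =>
      set σ := selectedString s e n with hσ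
      have hiff (i : ℕ) : (∀ u, bad (m (child (Nat.pair e (Encodable.encode σ), i)), u) = false) ↔
          (kbOrd (treeAt e) (σ ++ [i])).IllFounded := by
        obtain ⟨h1, h2⟩ := hkb e hdec (σ ++ [i])
        have hc : child (Nat.pair e (Encodable.encode σ), i) =
            Nat.pair e (Encodable.encode (σ ++ [i])) := by
          simp [child]
        rw [hc, ← hbad_iff _ h1, h2]
      obtain ⟨-, h2⟩ := hkb e hdec σ
      have hseq := hds (m (Nat.pair e (Encodable.encode σ))) (h2 ▸ ih)
      rw [h2] at hseq
      obtain ⟨i, hi, hill⟩ := exists_child_kbOrd_illFounded hseq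
      exact (hiff _).1 (hsel _ ⟨i, hi, (hiff i).2 hill⟩)
  intro n
  have := mem_of_kbOrd_illFounded hpc (hgood n)
  rwa [selectedString_eq_map] at this

end CFT
end

section
/- There exists a set X ⊆ ℕ that is loquaciously high for paths such that WF = {e : T_e is well-founded} is not computable from X. (The paper proves the stronger statement that there is such an X whose Turing jump is Turing equivalent to Kleene's O; in particular X does not compute the Π¹₁-complete set WF.) -/
namespace CFT

open Nat.Partrec (Code)

/-! ### Finite initial segments and functionals -/

/-- The initial segment `[f 0, …, f (k - 1)]`. -/
def initSeg (f : ℕ → ℕ) (k : ℕ) : List ℕ := (List.range k).map f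

@[simp] theorem length_initSeg (f : ℕ → ℕ) (k : ℕ) : (initSeg f k).length = k := by
  simp [initSeg]

theorem getD_initSeg {f : ℕ → ℕ} {k i : ℕ} (h : i < k) : (initSeg f k).getD i 0 = f i := by
  simp [initSeg, List.getD, h]

theorem take_initSeg {f : ℕ → ℕ} {j k : ℕ} (h : j ≤ k) : (initSeg f k).take j = initSeg f j := by
  simp [initSeg, ← List.map_take, List.take_range, h]

theorem initSeg_prefix {f : ℕ → ℕ} {j k : ℕ} (h : j ≤ k) : initSeg f j <+: initSeg f k :=
  take_initSeg (f := f) h ▸ List.take_prefix _ _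

theorem initSeg_congr {f g : ℕ → ℕ} {k : ℕ} (h : ∀ i < k, f i = g i) :
    initSeg f k = initSeg g k := by
  simpa [initSeg] using h

theorem initSeg_getD (l : List ℕ) : initSeg (l.getD · 0) l.length = l := by
  apply List.ext_getElem <;> simp +contextual [initSeg]

/-- A functional on finite oracle strings is monotone if longer strings give more answers. -/
def MonoFunctional (Φ : List ℕ → ℕ → Option ℕ) : Prop :=
  ∀ ⦃l l'⦄, l <+: l' → ∀ ⦃x y⦄, Φ l x = some y → Φ l' x = some y

/-- The functional performing the search `μ n. Φ l (a, n) = 0`. -/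
def searchFunctional (Φ : List ℕ → ℕ → Option ℕ) (l : List ℕ) (a : ℕ) : Option ℕ :=
  let i := (List.range l.length).findIdx fun n =>
    decide (Φ l (Nat.pair a n) = none ∨ Φ l (Nat.pair a n) = some 0)
  if Φ l (Nat.pair a i) = some 0 then some i else none

theorem searchFunctional_eq_some {Φ : List ℕ → ℕ → Option ℕ} {l : List ℕ} {a i : ℕ} :
    searchFunctional Φ l a = some i ↔ i ≤ l.length ∧ Φ l (Nat.pair a i) = some 0 ∧
      ∀ j < i, ∃ m, m ≠ 0 ∧ Φ l (Nat.pair a j) = some m := by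
  have key : ∀ v : Option ℕ, (∃ m, m ≠ 0 ∧ v = some m) ↔ ¬ (v = none ∨ v = some 0) := by
    rintro (_ | _ | m) <;> simp
  unfold searchFunctional
  simp only [key]
  set p : ℕ → Bool := fun n =>
    decide (Φ l (Nat.pair a n) = none ∨ Φ l (Nat.pair a n) = some 0) with hp
  have hle : (List.range l.length).findIdx p ≤ l.length := by
    simpa using List.findIdx_le_length (xs := List.range l.length) (p := p)
  have hlt : ∀ j < (List.range l.length).findIdx p, p j = false := by
    intro j hj
    simpa using List.not_of_lt_findIdx hj
  constructor
  · intro h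
    split_ifs at h with h0
    obtain rfl := Option.some.inj h
    exact ⟨hle, h0, fun j hj => by simpa [hp] using hlt j hj⟩
  · rintro ⟨hil, h0, hj⟩
    have : (List.range l.length).findIdx p = i := by
      refine le_antisymm ?_ (not_lt.mp fun hlt' => ?_)
      · by_contra hgt
        push Not at hgt
        have := hlt i hgt
        simp [hp, h0] at this
      · have h1 := hj _ hlt'
        have h2 : (List.range l.length).findIdx p < (List.range l.length).length := by
          simpa using lt_of_lt_of_le hlt' hil
        have h3 := List.findIdx_getElem (w := h2)
        simp only [List.getElem_range, hp, decide_eq_true_eq] at h3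
        exact h1 h3
    simp [this, h0]

theorem primrec_searchFunctional {Φ : List ℕ → ℕ → Option ℕ} (hΦ : Primrec₂ Φ) :
    Primrec₂ (searchFunctional Φ) := by
  have hv : Primrec₂ fun (q : List ℕ × ℕ) (n : ℕ) => Φ q.1 (Nat.pair q.2 n) :=
    hΦ.comp (Primrec.fst.comp Primrec.fst)
      (Primrec₂.natPair.comp (Primrec.snd.comp Primrec.fst) Primrec.snd)
  have hp : PrimrecRel fun (q : List ℕ × ℕ) (n : ℕ) =>
      Φ q.1 (Nat.pair q.2 n) = none ∨ Φ q.1 (Nat.pair q.2 n) = some 0 :=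
    PrimrecPred.or (Primrec.eq.comp hv (Primrec.const none))
      (Primrec.eq.comp hv (Primrec.const (some 0)))
  have hi : Primrec fun q : List ℕ × ℕ => (List.range q.1.length).findIdx fun n =>
      decide (Φ q.1 (Nat.pair q.2 n) = none ∨ Φ q.1 (Nat.pair q.2 n) = some 0) :=
    Primrec.list_findIdx (Primrec.list_range.comp (Primrec.list_length.comp Primrec.fst)) hp.decide
  exact Primrec.ite (Primrec.eq.comp (hv.comp Primrec.id hi) (Primrec.const (some 0)))
    (Primrec.option_some.comp hi) (Primrec.const none)

theorem monoFunctional_search {Φ : List ℕ → ℕ → Option ℕ} (hΦ : MonoFunctional Φ) :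
    MonoFunctional (searchFunctional Φ) := by
  intro l l' h x y hy
  rw [searchFunctional_eq_some] at hy ⊢
  obtain ⟨h1, h2, h3⟩ := hy
  refine ⟨h1.trans h.length_le, hΦ h h2, fun j hj => ?_⟩
  obtain ⟨m, hm, hmj⟩ := h3 j hj
  exact ⟨m, hm, hΦ h hmj⟩

/-- The functional performing primitive recursion. -/
def precFunctional (Φ Ψ : List ℕ → ℕ → Option ℕ) (l : List ℕ) (n : ℕ) : Option ℕ :=
  Nat.rec (Φ l n.unpair.1)
    (fun y IH => IH.bind fun i => Ψ l (Nat.pair n.unpair.1 (Nat.pair y i))) n.unpair.2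

theorem primrec_precFunctional {Φ Ψ : List ℕ → ℕ → Option ℕ} (hΦ : Primrec₂ Φ)
    (hΨ : Primrec₂ Ψ) : Primrec₂ (precFunctional Φ Ψ) := by
  open Primrec in
  have hu1 : Primrec fun q : List ℕ × ℕ => q.2.unpair.1 := fst.comp (Primrec.unpair.comp snd)
  have hu2 : Primrec fun q : List ℕ × ℕ => q.2.unpair.2 := snd.comp (Primrec.unpair.comp snd)
  have hstep : Primrec₂ fun (q : (List ℕ × ℕ) × ℕ × Option ℕ) (i : ℕ) =>
      Ψ q.1.1 (Nat.pair q.1.2.unpair.1 (Nat.pair q.2.1 i)) :=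
    hΨ.comp (fst.comp (fst.comp fst))
      (Primrec₂.natPair.comp (hu1.comp (fst.comp fst))
        (Primrec₂.natPair.comp (fst.comp (snd.comp fst)) snd))
  exact Primrec.nat_rec' hu2 (hΦ.comp fst hu1)
    (Primrec.option_bind (snd.comp snd) hstep).to₂

theorem monoFunctional_prec {Φ Ψ : List ℕ → ℕ → Option ℕ} (hΦ : MonoFunctional Φ)
    (hΨ : MonoFunctional Ψ) : MonoFunctional (precFunctional Φ Ψ) := by
  intro l l' h x
  unfold precFunctional
  generalize x.unpair.2 = n
  induction n with
  | zero => exact fun y hy => hΦ h hy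
  | succ n ih =>
    intro y hy
    simp only [Option.bind_eq_some_iff] at hy ⊢
    obtain ⟨i, hi, hiy⟩ := hy
    exact ⟨i, ih hi, hΨ h hiy⟩

/-- Every function that is recursive in `O` is approximated by a primitive recursive functional
evaluated on the initial segments of `O`. -/
theorem RecursiveIn.exists_functional {O : ℕ → ℕ} {f : ℕ →. ℕ} (hf : RecursiveIn O f) :
    ∃ Φ : List ℕ → ℕ → Option ℕ, Primrec₂ Φ ∧ MonoFunctional Φ ∧
      ∀ x, ∀ y ∈ f x, ∃ k, Φ (initSeg O k) x = some y := by
  open Primrec in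
  induction hf with
  | zero =>
    refine ⟨fun _ _ => some 0, Primrec.const _, fun _ _ _ _ _ h => h, fun x y hy => ⟨0, ?_⟩⟩
    exact congrArg some (Part.mem_some_iff.mp hy).symm
  | succ =>
    refine ⟨fun _ x => some (x + 1), option_some.comp (Primrec.succ.comp snd),
      fun _ _ _ _ _ h => h, fun x y hy => ⟨0, ?_⟩⟩
    exact congrArg some (Part.mem_some_iff.mp hy).symm
  | left =>
    refine ⟨fun _ x => some x.unpair.1, option_some.comp (fst.comp (unpair.comp snd)),
      fun _ _ _ _ _ h => h, fun x y hy => ⟨0, ?_⟩⟩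
    exact congrArg some (Part.mem_some_iff.mp hy).symm
  | right =>
    refine ⟨fun _ x => some x.unpair.2, option_some.comp (snd.comp (unpair.comp snd)),
      fun _ _ _ _ _ h => h, fun x y hy => ⟨0, ?_⟩⟩
    exact congrArg some (Part.mem_some_iff.mp hy).symm
  | oracle =>
    refine ⟨fun l x => l[x]?, list_getElem?, fun l l' h x y hy => ?_, fun x y hy => ⟨x + 1, ?_⟩⟩
    · obtain ⟨t, rfl⟩ := h
      have hx := (List.getElem?_eq_some_iff.mp hy).1
      simpa [List.getElem?_append_left hx] using hy
    · simpa [initSeg] using (Part.mem_some_iff.mp hy).symm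
  | @pair f g _ _ ihf ihg =>
    obtain ⟨Φ, hΦ, mΦ, cΦ⟩ := ihf
    obtain ⟨Ψ, hΨ, mΨ, cΨ⟩ := ihg
    refine ⟨fun l x => (Φ l x).bind fun a => (Ψ l x).map fun b => Nat.pair a b, ?_, ?_, ?_⟩
    · exact option_bind hΦ (option_map (hΨ.comp (fst.comp fst) (snd.comp fst))
        (Primrec₂.natPair.comp (snd.comp fst) snd).to₂).to₂
    · intro l l' h x y hy
      simp only [Option.bind_eq_some_iff, Option.map_eq_some_iff] at hy ⊢
      obtain ⟨a, ha, b, hb, rfl⟩ := hy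
      exact ⟨a, mΦ h ha, b, mΨ h hb, rfl⟩
    · intro x y hy
      simp only [Seq.seq, Part.map_eq_map, Part.mem_bind_iff, Part.mem_map_iff] at hy
      obtain ⟨_, ⟨a, ha, rfl⟩, b, hb, rfl⟩ := hy
      obtain ⟨k, hk⟩ := cΦ x a ha
      obtain ⟨j, hj⟩ := cΨ x b hb
      refine ⟨max k j, ?_⟩
      simp [mΦ (initSeg_prefix (le_max_left k j)) hk, mΨ (initSeg_prefix (le_max_right k j)) hj]
  | @comp f g _ _ ihf ihg =>
    obtain ⟨Φ, hΦ, mΦ, cΦ⟩ := ihf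
    obtain ⟨Ψ, hΨ, mΨ, cΨ⟩ := ihg
    refine ⟨fun l x => (Ψ l x).bind fun a => Φ l a, ?_, ?_, ?_⟩
    · exact option_bind hΨ (hΦ.comp (fst.comp fst) snd).to₂
    · intro l l' h x y hy
      simp only [Option.bind_eq_some_iff] at hy ⊢
      obtain ⟨a, ha, hy⟩ := hy
      exact ⟨a, mΨ h ha, mΦ h hy⟩
    · intro x y hy
      obtain ⟨a, ha, hy⟩ := Part.mem_bind_iff.mp hy
      obtain ⟨k, hk⟩ := cΦ a y hy
      obtain ⟨j, hj⟩ := cΨ x a ha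
      refine ⟨max k j, ?_⟩
      simp [mΦ (initSeg_prefix (le_max_left k j)) hk, mΨ (initSeg_prefix (le_max_right k j)) hj]
  | @prec f g _ _ ihf ihg =>
    obtain ⟨Φ, hΦ, mΦ, cΦ⟩ := ihf
    obtain ⟨Ψ, hΨ, mΨ, cΨ⟩ := ihg
    refine ⟨precFunctional Φ Ψ, primrec_precFunctional hΦ hΨ, monoFunctional_prec mΦ mΨ, ?_⟩
    intro x
    unfold precFunctional
    simp only [Nat.unpaired]
    generalize x.unpair.2 = n
    induction n with
    | zero => exact cΦ _
    | succ n ih =>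
      intro y hy
      simp only [Part.bind_eq_bind, Part.mem_bind_iff] at hy
      obtain ⟨i, hi, hy⟩ := hy
      obtain ⟨k, hk⟩ := ih i hi
      obtain ⟨j, hj⟩ := cΨ _ y hy
      refine ⟨max k j, ?_⟩
      have hk' := monoFunctional_prec mΦ mΨ (initSeg_prefix (f := O) (le_max_left k j))
        (x := Nat.pair x.unpair.1 n) (y := i) (by simpa [precFunctional] using hk)
      simp only [precFunctional, Nat.unpair_pair] at hk'
      simp [hk', mΨ (initSeg_prefix (le_max_right k j)) hj]
  | @rfind f _ ihf =>
    obtain ⟨Φ, hΦ, mΦ, cΦ⟩ := ihf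
    refine ⟨searchFunctional Φ, primrec_searchFunctional hΦ, monoFunctional_search mΦ, ?_⟩
    intro a n hn
    obtain ⟨h0, hlt⟩ := Nat.mem_rfind.mp hn
    have h0' : 0 ∈ f (Nat.pair a n) := by simpa using h0
    have hlt' : ∀ j < n, ∃ m, m ≠ 0 ∧ m ∈ f (Nat.pair a j) := by
      intro j hj
      obtain ⟨m, hm, hm'⟩ := by simpa using hlt hj
      exact ⟨m, hm', hm⟩
    have hex : ∀ j, ∃ k, j < n → ∃ m, m ≠ 0 ∧ Φ (initSeg O k) (Nat.pair a j) = some m := by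
      intro j
      by_cases hj : j < n
      · obtain ⟨m, hm, hm'⟩ := hlt' j hj
        obtain ⟨k, hk⟩ := cΦ _ m hm'
        exact ⟨k, fun _ => ⟨m, hm, hk⟩⟩
      · exact ⟨0, fun h => absurd h hj⟩
    choose κ hκ using hex
    obtain ⟨k₀, hk₀⟩ := cΦ _ _ h0'
    refine ⟨max (max n k₀) ((Finset.range n).sup κ), searchFunctional_eq_some.mpr ⟨?_, ?_, ?_⟩⟩
    · simp
    · exact mΦ (initSeg_prefix (by simp)) hk₀
    · intro j hj
      obtain ⟨m, hm, hm'⟩ := hκ j hj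
      refine ⟨m, hm, mΦ (initSeg_prefix (le_max_of_le_right ?_)) hm'⟩
      exact Finset.le_sup (f := κ) (Finset.mem_range.mpr hj)

/-! ### Coding a function by the complement of its graph -/

/-- The complement of the graph of `F`, as a set of natural numbers. -/
def coGraph (F : ℕ → ℕ) : Set ℕ := {n | F n.unpair.1 ≠ n.unpair.2}

theorem recursiveIn_coGraph (F : ℕ → ℕ) : RecursiveIn (chi (coGraph F)) ↑F := by
  have h := RecursiveIn.rfind (RecursiveIn.oracle (O := chi (coGraph F)))
  refine (congrArg (RecursiveIn _) (funext fun a => ?_)).mpr h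
  refine (Part.eq_some_iff.mpr (Nat.mem_rfind.mpr ⟨?_, fun {m} hm => ?_⟩)).symm
  · simp [chi, coGraph]
  · simpa [chi, coGraph] using hm.ne'

theorem loqHighForPaths_coGraph {F : ℕ → ℕ}
    (hF : ∀ e, IllFounded (treeAt e) → IsPath (treeAt e) fun n => F (Nat.pair e n)) :
    LoqHighForPaths (coGraph F) := by
  refine ⟨fun p => F (Nat.pair p.1 p.2), ?_, hF⟩
  unfold ComputableIn PartrecIn
  refine (congrArg (RecursiveIn _) (funext fun n => ?_)).mpr (recursiveIn_coGraph F)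
  simp [Part.bind_some]

/-- The initial segment of the characteristic function of `coGraph F` computed from an initial
segment of `F`. -/
def coGraphSeg (l : List ℕ) : List ℕ :=
  initSeg (fun n => if l.getD n.unpair.1 0 = n.unpair.2 then 0 else 1) l.length

theorem coGraphSeg_initSeg (F : ℕ → ℕ) (k : ℕ) :
    coGraphSeg (initSeg F k) = initSeg (chi (coGraph F)) k := by
  unfold coGraphSeg
  rw [length_initSeg]
  refine initSeg_congr fun n hn => ?_
  rw [getD_initSeg ((Nat.unpair_left_le n).trans_lt hn)]
  by_cases h : F n.unpair.1 = n.unpair.2 <;> simp [chi, coGraph, h]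

theorem coGraphSeg_prefix {l l' : List ℕ} (h : l <+: l') : coGraphSeg l <+: coGraphSeg l' := by
  have hl : l = initSeg (l'.getD · 0) l.length := by
    rw [← take_initSeg h.length_le, initSeg_getD]
    exact List.prefix_iff_eq_take.mp h
  rw [hl, ← initSeg_getD l', coGraphSeg_initSeg, coGraphSeg_initSeg, initSeg_getD]
  exact initSeg_prefix h.length_le

theorem primrec_coGraphSeg : Primrec coGraphSeg := by
  open Primrec in
  have hu : Primrec₂ fun (_ : List ℕ) (n : ℕ) => n.unpair := unpair.comp snd
  have hp : PrimrecPred fun q : List ℕ × ℕ => q.1.getD q.2.unpair.1 0 = q.2.unpair.2 :=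
    Primrec.eq.comp ((list_getD 0).comp fst (fst.comp hu)) (snd.comp hu)
  exact list_map (list_range.comp list_length) (Primrec.ite hp (const 0) (const 1)).to₂

theorem exists_functional_of_computableIn_coGraph {F g : ℕ → ℕ}
    (h : ComputableIn (chi (coGraph F)) g) :
    ∃ Φ : List ℕ → ℕ → Option ℕ, Primrec₂ Φ ∧ MonoFunctional Φ ∧
      ∀ x, ∃ k, Φ (initSeg F k) x = some (g x) := by
  obtain ⟨Φ, hΦ, mΦ, cΦ⟩ := RecursiveIn.exists_functional h
  refine ⟨fun l => Φ (coGraphSeg l), hΦ.comp (primrec_coGraphSeg.comp Primrec.fst) Primrec.snd,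
    fun l l' h => mΦ (coGraphSeg_prefix h), fun x => ?_⟩
  simp only [coGraphSeg_initSeg]
  exact cΦ x _ (by simp [Part.bind_some])

theorem countable_primrec_functional :
    {Φ : List ℕ → ℕ → Option ℕ | Primrec₂ Φ}.Countable := by
  have h : ∀ Φ : {Φ : List ℕ → ℕ → Option ℕ | Primrec₂ Φ}, ∃ c : Code,
      ∀ n, c.eval n = Part.some (Encodable.encode ((Encodable.decode (α := List ℕ × ℕ) n).map
        fun p => Φ.1 p.1 p.2)) := by
    rintro ⟨Φ, hΦ⟩
    have h1 : Primrec fun n : ℕ => Encodable.encode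
        ((Encodable.decode (α := List ℕ × ℕ) n).map fun p => Φ p.1 p.2) :=
      Primrec.encode.comp (Primrec.option_map Primrec.decode (Primrec₂.comp hΦ
        (Primrec.fst.comp Primrec.snd) (Primrec.snd.comp Primrec.snd)).to₂)
    obtain ⟨c, hc⟩ := Code.exists_code.mp (Nat.Partrec.of_primrec (Primrec.nat_iff.mp h1))
    exact ⟨c, fun n => by rw [hc]; rfl⟩
  choose c hc using h
  refine Set.countable_coe_iff.mp (Function.Injective.countable (f := c) fun Φ Ψ hcc => ?_)
  ext1
  funext l x
  have h1 := hc Φ (Encodable.encode (l, x))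
  rw [hcc, hc Ψ] at h1
  simpa [Encodable.encodek] using h1.symm

/-! ### Bounded classes of candidate path functions -/

/-- The `e`-th column of `F`, as far as it is visible below `k`, lies in the `e`-th tree, and `f`
bounds the computation times witnessing this. -/
def ColumnGood (f F : ℕ → ℕ) (e k : ℕ) : Prop :=
  ∀ n < k, n.unpair.1 = e → Code.evaln (f n) (Denumerable.ofNat Code e)
    (Encodable.encode (initSeg (fun i => F (Nat.pair e i)) n.unpair.2)) = some 1

theorem ColumnGood.mono {f F : ℕ → ℕ} {e j k : ℕ} (h : ColumnGood f F e k) (hjk : j ≤ k) :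
    ColumnGood f F e j := fun n hn => h n (hn.trans_le hjk)

theorem ColumnGood.congr {f f' F F' : ℕ → ℕ} {e k : ℕ} (h : ColumnGood f F e k)
    (hf : ∀ n < k, f n = f' n) (hF : ∀ i, Nat.pair e i < k → F (Nat.pair e i) = F' (Nat.pair e i)) :
    ColumnGood f' F' e k := by
  intro n hn he
  rw [← hf n hn, ← h n hn he]
  congr 2
  refine initSeg_congr fun i hi => (hF i ?_).symm
  calc Nat.pair e i < Nat.pair e n.unpair.2 := Nat.pair_lt_pair_right e hi
    _ = n := by rw [← he, Nat.pair_unpair]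
    _ < k := hn

/-- Up to `k`, `F` is bounded by `f`, and each column of `F` follows the corresponding tree for as
long as some function bounded by `f` does. -/
def Candidate (f F : ℕ → ℕ) (k : ℕ) : Prop :=
  (∀ i < k, F i ≤ f i) ∧
    ∀ j < k + 1, ∀ e < j, (∃ s : ℕ → ℕ, (∀ i < j, s i ≤ f i) ∧ ColumnGood f s e j) →
      ColumnGood f F e j

theorem Candidate.mono {f F : ℕ → ℕ} {j k : ℕ} (h : Candidate f F k) (hjk : j ≤ k) :
    Candidate f F j :=
  ⟨fun i hi => h.1 i (hi.trans_le hjk), fun m hm => h.2 m (by omega)⟩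

theorem Candidate.congr {f f' F F' : ℕ → ℕ} {k : ℕ} (h : Candidate f F k)
    (hf : ∀ n < k, f n = f' n) (hF : ∀ n < k, F n = F' n) : Candidate f' F' k := by
  refine ⟨fun i hi => hf i hi ▸ hF i hi ▸ h.1 i hi, fun j hj e he ⟨s, hs, hs'⟩ => ?_⟩
  refine (h.2 j hj e he ⟨s, fun i hi => ?_, ?_⟩).congr (fun n hn => hf n (by omega))
    (fun i hi => hF _ (by omega))
  · rw [hf i (by omega)]
    exact hs i hi
  · exact hs'.congr (fun n hn => (hf n (by omega)).symm) fun _ _ => rfl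

theorem exists_candidate (f : ℕ → ℕ) (k : ℕ) : ∃ F, Candidate f F k := by
  classical
  let P : ℕ → ℕ → Prop := fun e j => ∃ s : ℕ → ℕ, (∀ i < j, s i ≤ f i) ∧ ColumnGood f s e j
  have h0 : ∀ e, P e 0 := fun e => ⟨0, by simp, fun n hn => absurd hn (Nat.not_lt_zero n)⟩
  have hP : ∀ e, P e (Nat.findGreatest (P e) k) := fun e =>
    Nat.findGreatest_spec (Nat.zero_le k) (h0 e)
  choose s hs hs' using hP
  refine ⟨fun n => if n < Nat.findGreatest (P n.unpair.1) k then s n.unpair.1 n else 0,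
    fun i _ => ?_, fun j hj e _ hex => ?_⟩
  · dsimp only
    split_ifs with h
    · exact hs _ _ h
    · exact Nat.zero_le _
  · have hle : j ≤ Nat.findGreatest (P e) k := Nat.le_findGreatest (by omega) hex
    refine ((hs' e).mono hle).congr (fun _ _ => rfl) fun i hi => ?_
    simp [hi.trans_le hle]

/-- A bounding function that is large enough for every ill-founded tree. -/
theorem exists_bound : ∃ g : ℕ → ℕ, ∀ f F : ℕ → ℕ, (∀ i, g i ≤ f i) → (∀ k, Candidate f F k) →
    ∀ e, IllFounded (treeAt e) → IsPath (treeAt e) fun n => F (Nat.pair e n) := by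
  classical
  have hex : ∀ e, ∃ p t : ℕ → ℕ, IllFounded (treeAt e) → ∀ j,
      Code.evaln (t j) (Denumerable.ofNat Code e) (Encodable.encode (initSeg p j)) = some 1 := by
    intro e
    by_cases he : IllFounded (treeAt e)
    · obtain ⟨p, hp⟩ := id he
      have hdec : DecidesTree e := by
        by_contra hd
        simpa [treeAt, hd] using hp 0
      simp only [IsPath, treeAt, if_pos hdec, Set.mem_ofPred_eq, codeFn] at hp
      have ht : ∀ j, ∃ t, Code.evaln t (Denumerable.ofNat Code e)
          (Encodable.encode (initSeg p j)) = some 1 := fun j =>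
        Code.evaln_complete.mp (Part.eq_some_iff.mp (hp j))
      choose t ht using ht
      exact ⟨p, t, fun _ => ht⟩
    · exact ⟨0, 0, fun h => absurd h he⟩
  choose p t hpt using hex
  refine ⟨fun n => max (p n.unpair.1 n.unpair.2) (t n.unpair.1 n.unpair.2),
    fun f F hf hF e he => ?_⟩
  have hdec : DecidesTree e := by
    by_contra hd
    obtain ⟨q, hq⟩ := he
    simpa [treeAt, hd] using hq 0
  have hgood : ∀ k, ColumnGood f (fun n => p n.unpair.1 n.unpair.2) e k := by
    rintro k n - rfl
    simp only [Nat.unpair_pair]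
    exact Code.evaln_mono ((le_max_right _ _).trans (hf n)) (hpt _ he n.unpair.2)
  intro j
  have hk := (hF (Nat.pair e j + 1)).2 (Nat.pair e j + 1) (Nat.lt_succ_self _) e
    (Nat.lt_succ_of_le (Nat.left_le_pair e j))
    ⟨_, fun i _ => (le_max_left _ _).trans (hf i), hgood _⟩ (Nat.pair e j) (Nat.lt_succ_self _)
    (by simp)
  rw [Nat.unpair_pair] at hk
  simpa [treeAt, if_pos hdec, codeFn] using! Part.eq_some_iff.mpr (Code.evaln_sound hk)

/-! ### Primitive recursiveness of the candidate classes -/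

theorem primrecPred_forall_mem_list {α β : Type} [Primcodable α] [Primcodable β]
    {p : α → β → Prop} {f : α → List β} (hp : PrimrecRel p) (hf : Primrec f) :
    PrimrecPred fun a => ∀ b ∈ f a, p a b :=
  (PrimrecRel.forall_mem_list hp.swap).comp hf Primrec.id

theorem primrecPred_forall_lt {α : Type} [Primcodable α] {p : α → ℕ → Prop} {f : α → ℕ}
    (hp : PrimrecRel p) (hf : Primrec f) : PrimrecPred fun a => ∀ n < f a, p a n :=
  (primrecPred_forall_mem_list hp (Primrec.list_range.comp hf)).of_eq fun _ => by simp

theorem primrecPred_exists_mem_list {α β : Type} [Primcodable α] [Primcodable β]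
    {p : α → β → Prop} {f : α → List β} (hp : PrimrecRel p) (hf : Primrec f) :
    PrimrecPred fun a => ∃ b ∈ f a, p a b :=
  (PrimrecRel.exists_mem_list hp.swap).comp hf Primrec.id

theorem primrecPred_imp {α : Type} [Primcodable α] {p q : α → Prop} (hp : PrimrecPred p)
    (hq : PrimrecPred q) : PrimrecPred fun a => p a → q a :=
  (hp.not.or hq).of_eq fun _ => imp_iff_not_or.symm

/-- All lists of the same length as `l` that are pointwise bounded by `l`. -/
def boundedLists (l : List ℕ) : List (List ℕ) :=
  l.foldr (fun a L => (List.range (a + 1)).flatMap fun b => L.map (b :: ·)) [[]]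

theorem mem_boundedLists {s l : List ℕ} :
    s ∈ boundedLists l ↔ s.length = l.length ∧ ∀ i < l.length, s.getD i 0 ≤ l.getD i 0 := by
  induction l generalizing s with
  | nil => simp [boundedLists]
  | cons a l ih =>
    have h : s ∈ boundedLists (a :: l) ↔ ∃ b ≤ a, ∃ t ∈ boundedLists l, b :: t = s := by
      simp [boundedLists]
    rw [h]
    constructor
    · rintro ⟨b, hb, t, ht, rfl⟩
      obtain ⟨h1, h2⟩ := ih.mp ht
      refine ⟨by simp [h1], fun i hi => ?_⟩
      rcases i with _ | i
      · simpa using hb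
      · simpa using h2 i (by simpa using hi)
    · rintro ⟨h1, h2⟩
      rcases s with _ | ⟨b, t⟩
      · simp at h1
      · refine ⟨b, by simpa using h2 0 (by simp), t, ih.mpr ⟨by simpa using h1, fun i hi => ?_⟩, rfl⟩
        simpa using h2 (i + 1) (by simpa using hi)

theorem primrec_boundedLists : Primrec boundedLists := by
  open Primrec in
  have h1 : Primrec₂ fun (q : (List ℕ × ℕ × List (List ℕ)) × ℕ) (t : List ℕ) => q.2 :: t :=
    list_cons.comp (snd.comp fst) snd
  have h2 : Primrec₂ fun (q : List ℕ × ℕ × List (List ℕ)) (b : ℕ) => q.2.2.map (b :: ·) :=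
    (list_map (snd.comp (snd.comp fst)) h1).to₂
  exact list_foldr Primrec.id (const [[]])
    (list_flatMap (list_range.comp (Primrec.succ.comp (fst.comp snd))) h2).to₂

theorem primrecPred_columnGood : PrimrecPred fun q : (List ℕ × List ℕ) × ℕ × ℕ =>
    ColumnGood (q.1.1.getD · 0) (q.1.2.getD · 0) q.2.1 q.2.2 := by
  open Primrec in
  have hcol : Primrec fun r : ((List ℕ × List ℕ) × ℕ × ℕ) × ℕ =>
      initSeg (fun i => r.1.1.2.getD (Nat.pair r.1.2.1 i) 0) r.2.unpair.2 :=
    list_map (list_range.comp (snd.comp (unpair.comp snd)))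
      ((list_getD 0).comp (snd.comp (fst.comp (fst.comp fst)))
        (Primrec₂.natPair.comp (fst.comp (snd.comp (fst.comp fst))) snd)).to₂
  have hev : Primrec fun r : ((List ℕ × List ℕ) × ℕ × ℕ) × ℕ =>
      Code.evaln (r.1.1.1.getD r.2 0) (Denumerable.ofNat Code r.1.2.1)
        (Encodable.encode (initSeg (fun i => r.1.1.2.getD (Nat.pair r.1.2.1 i) 0) r.2.unpair.2)) :=
    Code.primrec_evaln.comp (((((list_getD 0).comp (fst.comp (fst.comp fst)) snd)).pair
      ((Primrec.ofNat Code).comp (fst.comp (snd.comp fst)))).pair (Primrec.encode.comp hcol))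
  have hp : PrimrecRel fun (q : (List ℕ × List ℕ) × ℕ × ℕ) (n : ℕ) => n.unpair.1 = q.2.1 →
      Code.evaln (q.1.1.getD n 0) (Denumerable.ofNat Code q.2.1)
        (Encodable.encode (initSeg (fun i => q.1.2.getD (Nat.pair q.2.1 i) 0) n.unpair.2)) =
          some 1 :=
    primrecPred_imp (Primrec.eq.comp (fst.comp (unpair.comp snd)) (fst.comp (snd.comp fst)))
      (Primrec.eq.comp hev (const (some 1)))
  exact primrecPred_forall_lt hp (snd.comp snd)

theorem exists_columnGood_iff {τ : List ℕ} {e j : ℕ} (hj : j ≤ τ.length) :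
    (∃ s : ℕ → ℕ, (∀ i < j, s i ≤ τ.getD i 0) ∧ ColumnGood (τ.getD · 0) s e j) ↔
      ∃ s ∈ boundedLists τ, ColumnGood (τ.getD · 0) (s.getD · 0) e j := by
  constructor
  · rintro ⟨s, hs, hs'⟩
    refine ⟨initSeg (fun i => if i < j then s i else 0) τ.length,
      mem_boundedLists.mpr ⟨by simp, fun i hi => ?_⟩, hs'.congr (fun _ _ => rfl) fun i hi => ?_⟩
    · rw [getD_initSeg hi]
      split_ifs with h
      · exact hs i h
      · exact Nat.zero_le _
    · rw [getD_initSeg (hi.trans_le hj), if_pos hi]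
  · rintro ⟨s, hs, hs'⟩
    exact ⟨_, fun i hi => (mem_boundedLists.mp hs).2 i (hi.trans_le hj), hs'⟩

theorem primrecRel_candidate : PrimrecRel fun τ ρ : List ℕ =>
    Candidate (τ.getD · 0) (ρ.getD · 0) τ.length := by
  open Primrec in
  have hgetD := list_getD (0 : ℕ)
  have hle : PrimrecPred fun q : List ℕ × List ℕ =>
      ∀ i < q.1.length, q.2.getD i 0 ≤ q.1.getD i 0 :=
    primrecPred_forall_lt (p := fun (q : List ℕ × List ℕ) i => q.2.getD i 0 ≤ q.1.getD i 0)
      (nat_le.comp (hgetD.comp (snd.comp fst) snd) (hgetD.comp (fst.comp fst) snd))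
      (list_length.comp fst)
  have hs : PrimrecPred fun q : ((List ℕ × List ℕ) × ℕ) × ℕ =>
      ∃ s ∈ boundedLists q.1.1.1, ColumnGood (q.1.1.1.getD · 0) (s.getD · 0) q.2 q.1.2 :=
    primrecPred_exists_mem_list (p := fun (q : ((List ℕ × List ℕ) × ℕ) × ℕ) (s : List ℕ) =>
      ColumnGood (q.1.1.1.getD · 0) (s.getD · 0) q.2 q.1.2)
      (primrecPred_columnGood.comp (((fst.comp (fst.comp (fst.comp fst))).pair snd).pair
        ((snd.comp fst).pair (snd.comp (fst.comp fst)))))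
      (primrec_boundedLists.comp (fst.comp (fst.comp fst)))
  have hg : PrimrecPred fun q : ((List ℕ × List ℕ) × ℕ) × ℕ =>
      ColumnGood (q.1.1.1.getD · 0) (q.1.1.2.getD · 0) q.2 q.1.2 :=
    primrecPred_columnGood.comp ((fst.comp fst).pair (snd.pair (snd.comp fst)))
  have he : PrimrecPred fun q : (List ℕ × List ℕ) × ℕ => ∀ e < q.2,
      (∃ s ∈ boundedLists q.1.1, ColumnGood (q.1.1.getD · 0) (s.getD · 0) e q.2) →
        ColumnGood (q.1.1.getD · 0) (q.1.2.getD · 0) e q.2 :=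
    primrecPred_forall_lt (p := fun (q : (List ℕ × List ℕ) × ℕ) e =>
      (∃ s ∈ boundedLists q.1.1, ColumnGood (q.1.1.getD · 0) (s.getD · 0) e q.2) →
        ColumnGood (q.1.1.getD · 0) (q.1.2.getD · 0) e q.2) (primrecPred_imp hs hg) snd
  have hj := primrecPred_forall_lt (p := fun (q : List ℕ × List ℕ) j => ∀ e < j,
      (∃ s ∈ boundedLists q.1, ColumnGood (q.1.getD · 0) (s.getD · 0) e j) →
        ColumnGood (q.1.getD · 0) (q.2.getD · 0) e j) he
    (Primrec.succ.comp (list_length.comp fst))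
  refine (hle.and hj).of_eq fun q => and_congr_right fun _ => ?_
  refine forall₂_congr fun j hj => forall₂_congr fun e _ => ?_
  rw [exists_columnGood_iff (Nat.lt_succ_iff.mp hj)]

/-! ### A self-referential tree -/

theorem exists_treeAt_eq {P : ℕ → List ℕ → Prop} (hP : PrimrecRel P)
    (hclosed : ∀ e, PrefixClosed {l | P e l}) : ∃ e, treeAt e = {l | P e l} := by
  classical
  have hf : Primrec₂ fun (c : Code) (n : ℕ) =>
      if P (Encodable.encode c) (Denumerable.ofNat (List ℕ) n) then 1 else 0 :=
    Primrec.ite (hP.comp (Primrec.encode.comp Primrec.fst)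
      ((Primrec.ofNat (List ℕ)).comp Primrec.snd)) (Primrec.const 1) (Primrec.const 0)
  obtain ⟨c, hc⟩ := Code.fixed_point₂ (f := fun c n => Part.some
    (if P (Encodable.encode c) (Denumerable.ofNat (List ℕ) n) then 1 else 0))
    (Primrec₂.to_comp hf).partrec₂
  have hcode : ∀ n, codeFn (Encodable.encode c) n = Part.some
      (if P (Encodable.encode c) (Denumerable.ofNat (List ℕ) n) then 1 else 0) := by
    intro n
    simp [codeFn, hc]
  have hset : {l : List ℕ | codeFn (Encodable.encode c) (Encodable.encode l) = Part.some 1} =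
      {l | P (Encodable.encode c) l} := by
    ext l
    simp [hcode]
  have hdec : DecidesTree (Encodable.encode c) := by
    refine ⟨fun n => by simp [hcode], ?_⟩
    rw [hset]
    exact hclosed _
  exact ⟨Encodable.encode c, by rw [treeAt, if_pos hdec, hset]⟩

/-- `τ` extends `σ` and dominates `l` beyond `σ`. -/
def ExtendsAbove (σ l τ : List ℕ) : Prop :=
  (σ.length ≤ τ.length ∧ τ.length ≤ l.length) ∧ ∀ i < τ.length,
    (i < σ.length ∧ τ.getD i 0 = σ.getD i 0) ∨ (σ.length ≤ i ∧ l.getD i 0 ≤ τ.getD i 0)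

theorem ExtendsAbove.mono {σ l l' τ : List ℕ} (h : ExtendsAbove σ l τ) (hl : l <+: l') :
    ExtendsAbove σ l' τ := by
  refine ⟨⟨h.1.1, h.1.2.trans hl.length_le⟩, fun i hi => (h.2 i hi).imp_right fun h' => ⟨h'.1, ?_⟩⟩
  obtain ⟨t, rfl⟩ := hl
  rw [List.getD_append _ _ _ _ (hi.trans_le h.1.2)]
  exact h'.2

theorem primrecRel_extendsAbove (σ : List ℕ) : PrimrecRel (ExtendsAbove σ) := by
  open Primrec in
  have hgetD := list_getD (0 : ℕ)
  refine PrimrecPred.and ((nat_le.comp (const _) (list_length.comp snd)).and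
    (nat_le.comp (list_length.comp snd) (list_length.comp fst))) ?_
  refine primrecPred_forall_lt (p := fun (q : List ℕ × List ℕ) i =>
    (i < σ.length ∧ q.2.getD i 0 = σ.getD i 0) ∨ (σ.length ≤ i ∧ q.1.getD i 0 ≤ q.2.getD i 0))
    ?_ (list_length.comp snd)
  exact ((nat_lt.comp snd (const _)).and (Primrec.eq.comp (hgetD.comp (snd.comp fst) snd)
    (hgetD.comp (const σ) snd))).or ((nat_le.comp (const _) snd).and
      (nat_le.comp (hgetD.comp (fst.comp fst) snd) (hgetD.comp (snd.comp fst) snd)))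

/-- Every candidate along `τ` satisfying `R` makes `Φ` output `0` at `e`. -/
def Decides (R : List ℕ → Prop) (Φ : List ℕ → ℕ → Option ℕ) (e : ℕ) (τ : List ℕ) : Prop :=
  ∀ ρ ∈ boundedLists τ, Candidate (τ.getD · 0) (ρ.getD · 0) τ.length → R ρ → Φ ρ e = some 0

theorem primrecRel_decides {R : List ℕ → Prop} {Φ : List ℕ → ℕ → Option ℕ} (hR : PrimrecPred R)
    (hΦ : Primrec₂ Φ) : PrimrecRel (Decides R Φ) := by
  open Primrec in
  exact primrecPred_forall_mem_list (p := fun (q : ℕ × List ℕ) ρ =>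
    Candidate (q.2.getD · 0) (ρ.getD · 0) q.2.length → R ρ → Φ ρ q.1 = some 0)
    (primrecPred_imp (primrecRel_candidate.comp (snd.comp fst) snd) (primrecPred_imp (hR.comp snd)
      (Primrec.eq.comp (hΦ.comp snd (fst.comp fst)) (const (some 0)))))
    (primrec_boundedLists.comp snd)

theorem decides_initSeg_iff {R : List ℕ → Prop} {Φ : List ℕ → ℕ → Option ℕ} {e m : ℕ}
    {f : ℕ → ℕ} : Decides R Φ e (initSeg f m) ↔
      ∀ F, Candidate f F m → R (initSeg F m) → Φ (initSeg F m) e = some 0 := by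
  have hf : ∀ n < m, (initSeg f m).getD n 0 = f n := fun n hn => getD_initSeg hn
  unfold Decides
  rw [length_initSeg]
  constructor
  · intro h F hF hR
    have hF' : ∀ n < m, F n = (initSeg F m).getD n 0 := fun n hn => (getD_initSeg hn).symm
    refine h _ (mem_boundedLists.mpr ⟨by simp, fun i hi => ?_⟩)
      (hF.congr (fun n hn => (hf n hn).symm) hF') hR
    rw [length_initSeg] at hi
    rw [hf i hi, ← hF' i hi]
    exact hF.1 i hi
  · intro h ρ hρ hC hR
    have hlen : ρ.length = m := by simpa using (mem_boundedLists.mp hρ).1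
    have hseg : initSeg (ρ.getD · 0) m = ρ := hlen ▸ initSeg_getD ρ
    have := h (ρ.getD · 0) (hC.congr hf fun _ _ => rfl)
    rw [hseg] at this
    exact this hR

/-- There is an index `e` such that a path through the `e`-th tree is a function above which no
extension of `σ` decides `Φ` to output `0` at `e`. -/
theorem exists_selfReferential_tree {R : List ℕ → Prop} {Φ : List ℕ → ℕ → Option ℕ}
    (hR : PrimrecPred R) (hΦ : Primrec₂ Φ) (σ : List ℕ) :
    ∃ e, ∀ h : ℕ → ℕ, IsPath (treeAt e) h ↔
      ∀ L τ, ExtendsAbove σ (initSeg h L) τ → ¬ Decides R Φ e τ := by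
  open Primrec in
  have hdec : PrimrecPred fun q : (ℕ × List ℕ) × ℕ =>
      ExtendsAbove σ q.1.2 (Denumerable.ofNat (List ℕ) q.2) →
        ¬ Decides R Φ q.1.1 (Denumerable.ofNat (List ℕ) q.2) :=
    primrecPred_imp
      ((primrecRel_extendsAbove σ).comp (snd.comp fst) ((Primrec.ofNat (List ℕ)).comp snd))
      ((primrecRel_decides hR hΦ).comp (fst.comp fst) ((Primrec.ofNat (List ℕ)).comp snd)).not
  obtain ⟨e, he⟩ := exists_treeAt_eq (P := fun e l => ∀ c < l.length,
      ExtendsAbove σ l (Denumerable.ofNat (List ℕ) c) →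
        ¬ Decides R Φ e (Denumerable.ofNat (List ℕ) c))
    (primrecPred_forall_lt (p := fun (q : ℕ × List ℕ) c =>
      ExtendsAbove σ q.2 (Denumerable.ofNat (List ℕ) c) →
        ¬ Decides R Φ q.1 (Denumerable.ofNat (List ℕ) c)) hdec (list_length.comp snd))
    (fun e l hl l' hl' c hc h => hl c (hc.trans_le hl'.length_le) (h.mono hl'))
  refine ⟨e, fun h => ⟨fun hpath L τ hτ => ?_, fun hno k => ?_⟩⟩
  · have hp := hpath (max L (Encodable.encode τ + 1))
    rw [he] at hp
    simpa using! hp (Encodable.encode τ) (by simp)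
      (by simpa using! hτ.mono (initSeg_prefix (le_max_left _ _)))
  · rw [he]
    exact fun c _ hc => hno k _ hc

/-! ### Forcing -/

/-- A forcing condition: the values of `bound` below `stem` are fixed, those beyond are lower
bounds, and `allowed` restricts the candidates. The condition is never violated by its bounds. -/
structure Condition where
  stem : ℕ
  bound : ℕ → ℕ
  allowed : List ℕ → Prop
  primrecPred_allowed : PrimrecPred allowed
  allowed_of_prefix : ∀ ⦃l l'⦄, l <+: l' → allowed l' → allowed l
  exists_allowed : ∀ f : ℕ → ℕ, (∀ i, bound i ≤ f i) → (∀ i < stem, f i = bound i) →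
    ∀ m, ∃ F, Candidate f F m ∧ allowed (initSeg F m)

/-- `q` is a stronger condition than `p`, with a longer stem. -/
structure Condition.Extends (q p : Condition) : Prop where
  stem_lt : p.stem < q.stem
  bound_le : ∀ i, p.bound i ≤ q.bound i
  bound_eq : ∀ i < p.stem, q.bound i = p.bound i
  allowed : ∀ l, q.allowed l → p.allowed l

/-- The functional `Φ` does not compute `WF` from any function all of whose initial segments are
allowed. -/
def Condition.Defeats (q : Condition) (Φ : List ℕ → ℕ → Option ℕ) : Prop :=
  ∃ x, ∀ l, q.allowed l → Φ l x ≠ some (chi WF x)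

theorem Condition.exists_decided_of_not_defeats {p : Condition} {Φ : List ℕ → ℕ → Option ℕ}
    (hΦ : Primrec₂ Φ) (mΦ : MonoFunctional Φ)
    (hp : ∀ q : Condition, q.Extends p → ¬ q.Defeats Φ) (x k : ℕ) (h : ℕ → ℕ)
    (hk : p.stem < k) (hle : ∀ i, p.bound i ≤ h i) (heq : ∀ i < p.stem, h i = p.bound i) :
    ∃ f : ℕ → ℕ, (∀ i, h i ≤ f i) ∧ (∀ i < k, f i = h i) ∧
      ∃ m, ∀ F, Candidate f F m → p.allowed (initSeg F m) →
        Φ (initSeg F m) x = some (chi WF x) := by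
  by_contra hcon
  push Not at hcon
  let q : Condition :=
    { stem := k
      bound := h
      allowed := fun l => p.allowed l ∧ Φ l x ≠ some (chi WF x)
      primrecPred_allowed := p.primrecPred_allowed.and (Primrec.eq.comp
        (hΦ.comp Primrec.id (Primrec.const x)) (Primrec.const (some (chi WF x)))).not
      allowed_of_prefix := fun _ _ hl h' =>
        ⟨p.allowed_of_prefix hl h'.1, fun he => h'.2 (mΦ hl he)⟩
      exists_allowed := fun f hf hf' m => by
        obtain ⟨F, h1, h2, h3⟩ := hcon f hf hf' m
        exact ⟨F, h1, h2, h3⟩ }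
  exact hp q ⟨hk, hle, heq, fun _ hl => hl.1⟩ ⟨x, fun _ hl => hl.2⟩

theorem Condition.exists_extends_defeats (p : Condition) {Φ : List ℕ → ℕ → Option ℕ}
    (hΦ : Primrec₂ Φ) (mΦ : MonoFunctional Φ) :
    ∃ q : Condition, q.Extends p ∧ q.Defeats Φ := by
  by_contra hcon
  push Not at hcon
  have key := p.exists_decided_of_not_defeats hΦ mΦ hcon
  obtain ⟨e, he⟩ := exists_selfReferential_tree p.primrecPred_allowed hΦ (initSeg p.bound p.stem)
  by_cases hill : IllFounded (treeAt e)
  · obtain ⟨u, hu⟩ := id hill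
    have h0 : chi WF e = 0 := by simp [chi, WF, hill]
    obtain ⟨f, hf, hf', m, hm⟩ := key e (p.stem + 1)
      (fun i => if i < p.stem then p.bound i else max (p.bound i) (u i)) (Nat.lt_succ_self _)
      (fun i => by split_ifs <;> simp) (fun i hi => by simp [hi])
    rw [h0] at hm
    refine (he u).mp hu (max m p.stem) (initSeg f (max m p.stem)) ⟨by simp, fun i hi => ?_⟩
      (decides_initSeg_iff.mpr fun F hF hR => ?_)
    · rw [length_initSeg] at hi
      rw [length_initSeg, getD_initSeg hi, getD_initSeg hi]
      rcases lt_or_ge i p.stem with h | h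
      · left
        rw [getD_initSeg h, hf' i (by omega), if_pos h]
        exact ⟨h, rfl⟩
      · right
        have := hf i
        rw [if_neg (by omega)] at this
        exact ⟨h, (le_max_right _ _).trans this⟩
    · have hseg := initSeg_prefix (f := F) (le_max_left m p.stem)
      exact mΦ hseg (hm F (hF.mono (le_max_left _ _)) (p.allowed_of_prefix hseg hR))
  · have h1 : chi WF e = 1 := by simp [chi, WF, hill]
    have hnp : ¬ IsPath (treeAt e) p.bound := fun h => hill ⟨_, h⟩
    rw [he] at hnp
    push Not at hnp
    obtain ⟨L, τ, hτ, hdec⟩ := hnp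
    obtain ⟨⟨hlen, hlenL⟩, hval⟩ := hτ
    rw [length_initSeg] at hlen hlenL
    have hval' : ∀ i < τ.length, (i < p.stem ∧ τ.getD i 0 = p.bound i) ∨
        (p.stem ≤ i ∧ p.bound i ≤ τ.getD i 0) := by
      intro i hi
      have := hval i hi
      rw [length_initSeg, getD_initSeg (f := p.bound) (k := L) (by omega)] at this
      refine this.imp_left fun ⟨h, h'⟩ => ⟨h, ?_⟩
      rw [h', getD_initSeg h]
    set b : ℕ → ℕ := fun i => if i < τ.length then τ.getD i 0 else p.bound i with hb
    have hb_le : ∀ i, p.bound i ≤ b i := by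
      intro i
      by_cases hi : i < τ.length
      · simp only [hb, if_pos hi]
        rcases hval' i hi with ⟨_, h⟩ | ⟨_, h⟩
        · exact h.ge
        · exact h
      · simp [hb, hi]
    have hb_eq : ∀ i < p.stem, b i = p.bound i := by
      intro i hi
      have hi' : i < τ.length := by omega
      simp only [hb, if_pos hi']
      rcases hval' i hi' with ⟨_, h⟩ | ⟨h, _⟩
      · exact h
      · omega
    obtain ⟨f, hf, hf', m, hm⟩ := key e (τ.length + p.stem + 1) b (by omega) hb_le hb_eq
    rw [h1] at hm
    obtain ⟨F, hF, hR⟩ := p.exists_allowed f (fun i => (hb_le i).trans (hf i))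
      (fun i hi => by rw [hf' i (by omega), hb_eq i hi]) (max m τ.length)
    have hseg_m := initSeg_prefix (f := F) (le_max_left m τ.length)
    have hseg_τ := initSeg_prefix (f := F) (le_max_right m τ.length)
    have hone := mΦ hseg_m (hm F (hF.mono (le_max_left _ _)) (p.allowed_of_prefix hseg_m hR))
    have hτf : initSeg f τ.length = τ := by
      rw [initSeg_congr (g := (τ.getD · 0)), initSeg_getD]
      intro i hi
      rw [hf' i (by omega)]
      simp only [hb, if_pos hi]
    rw [← hτf] at hdec
    have hzero := mΦ hseg_τ (decides_initSeg_iff.mp hdec F (hF.mono (le_max_right _ _))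
      (p.allowed_of_prefix hseg_τ hR))
    rw [hone] at hzero
    simp at hzero

/-- The weakest condition with a given bounding function. -/
def Condition.ofBound (g : ℕ → ℕ) : Condition where
  stem := 0
  bound := g
  allowed := fun _ => True
  primrecPred_allowed := PrimrecPred.of_eq (Primrec.eq.comp (Primrec.const 0) (Primrec.const 0))
    fun _ => by simp
  allowed_of_prefix := fun _ _ _ _ => trivial
  exists_allowed := fun f _ _ m => (exists_candidate f m).imp fun _ h => ⟨h, trivial⟩

/-! ### The generic function -/

theorem isClosed_of_initSeg {S : Set (ℕ → ℕ)} (n : ℕ)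
    (hS : ∀ F G : ℕ → ℕ, (∀ i < n, F i = G i) → F ∈ S → G ∈ S) : IsClosed S := by
  refine ⟨isOpen_iff_forall_mem_open.mpr fun F hF =>
    ⟨(Finset.range n : Set ℕ).pi fun i => {F i}, fun G hG hGS => hF (hS G F (fun i hi => ?_) hGS),
      isOpen_set_pi (Finset.finite_toSet _) fun _ _ => isOpen_discrete _, fun _ _ => rfl⟩⟩
  exact hG i (by simpa using hi)

/-- The limit of a sequence of conditions determines a candidate that is allowed by all of
them. -/
theorem exists_generic {p : ℕ → Condition} (hp : ∀ n, (p (n + 1)).Extends (p n)) :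
    ∃ f F : ℕ → ℕ, (∀ i, (p 0).bound i ≤ f i) ∧
      (∀ n, Candidate f F n) ∧ ∀ n k, (p n).allowed (initSeg F k) := by
  have hstem : ∀ n, n ≤ (p n).stem := by
    intro n
    induction n with
    | zero => exact Nat.zero_le _
    | succ n ih => exact ih.trans_lt (hp n).stem_lt
  have hstem_mono : Monotone fun n => (p n).stem :=
    monotone_nat_of_le_succ fun n => (hp n).stem_lt.le
  have hbound_mono : ∀ i, Monotone fun n => (p n).bound i := fun i =>
    monotone_nat_of_le_succ fun n => (hp n).bound_le i
  have hbound_eq : ∀ i n m, n ≤ m → i < (p n).stem → (p m).bound i = (p n).bound i := by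
    intro i n m hnm hi
    induction m, hnm using Nat.le_induction with
    | base => rfl
    | succ m hnm ih => rw [(hp m).bound_eq i (hi.trans_le (hstem_mono hnm)), ih]
  set f : ℕ → ℕ := fun i => (p (i + 1)).bound i with hf
  have hf_eq : ∀ n i, i < (p n).stem → f i = (p n).bound i := by
    intro n i hi
    rcases le_total n (i + 1) with h | h
    · exact hbound_eq i n _ h hi
    · exact (hbound_eq i _ n h (hstem (i + 1))).symm
  have hf_le : ∀ n i, (p n).bound i ≤ f i := by
    intro n i
    rcases le_total n (i + 1) with h | h
    · exact hbound_mono i h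
    · exact (hbound_eq i _ n h (hstem (i + 1))).le
  let t : ℕ → Set (ℕ → ℕ) := fun n =>
    (Set.univ.pi fun i => Set.Iic (f i)) ∩ {F | Candidate f F n ∧ (p n).allowed (initSeg F n)}
  have ht_closed : ∀ n, IsClosed (t n) := fun n =>
    (isClosed_set_pi fun _ _ => isClosed_discrete _).inter <| isClosed_of_initSeg n
      fun F G hFG ⟨h1, h2⟩ => ⟨h1.congr (fun _ _ => rfl) hFG, initSeg_congr hFG ▸ h2⟩
  have ht_compact : IsCompact (t 0) :=
    (isCompact_univ_pi fun i => (Set.finite_Iic (f i)).isCompact).of_isClosed_subset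
      (ht_closed 0) Set.inter_subset_left
  have ht_anti : ∀ n, t (n + 1) ⊆ t n := fun n F ⟨h0, h1, h2⟩ =>
    ⟨h0, h1.mono n.le_succ, (p n).allowed_of_prefix (initSeg_prefix n.le_succ)
      ((hp n).allowed _ h2)⟩
  have ht_nonempty : ∀ n, (t n).Nonempty := by
    intro n
    obtain ⟨F, hF, hF'⟩ := (p n).exists_allowed f (hf_le n) (hf_eq n) n
    have hcongr : ∀ i < n, F i = if i < n then F i else 0 := fun i hi => by simp [hi]
    refine ⟨fun i => if i < n then F i else 0, fun i _ => ?_, hF.congr (fun _ _ => rfl) hcongr,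
      initSeg_congr hcongr ▸ hF'⟩
    simp only [Set.mem_Iic]
    split_ifs with h
    · exact hF.1 i h
    · exact Nat.zero_le _
  obtain ⟨F, hF⟩ := IsCompact.nonempty_iInter_of_sequence_nonempty_isCompact_isClosed t ht_anti
    ht_nonempty ht_compact ht_closed
  have hallowed : ∀ n m, n ≤ m → ∀ l, (p m).allowed l → (p n).allowed l := by
    intro n m hnm
    induction m, hnm using Nat.le_induction with
    | base => exact fun _ h => h
    | succ m _ ih => exact fun l h => ih l ((hp m).allowed l h)
  have hmem : ∀ n, Candidate f F n ∧ (p n).allowed (initSeg F n) := fun n =>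
    (Set.mem_iInter.mp hF n).2
  exact ⟨f, F, hf_le 0, fun n => (hmem n).1, fun n k =>
    (p n).allowed_of_prefix (initSeg_prefix (le_max_right n k))
      (hallowed n _ (le_max_left n k) _ (hmem _).2)⟩

/-- There is a set `X` that is loquaciously high for paths such that
`WF` is not computable from `X`. -/
theorem exists_loqHighForPaths_not_computing_WF :
    ∃ X : Set ℕ, LoqHighForPaths X ∧ ¬ ComputableIn (chi X) (chi WF) := by
  obtain ⟨g, hg⟩ := exists_bound
  obtain ⟨Φ, hΦ⟩ : ∃ Φ : ℕ → List ℕ → ℕ → Option ℕ,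
      {Ψ : List ℕ → ℕ → Option ℕ | Primrec₂ Ψ ∧ MonoFunctional Ψ} = Set.range Φ :=
    (countable_primrec_functional.mono fun _ h => h.1).exists_eq_range
      ⟨fun _ _ => none, Primrec.const _, fun _ _ _ _ _ h => h⟩
  have hmem : ∀ n, Primrec₂ (Φ n) ∧ MonoFunctional (Φ n) := fun n =>
    hΦ.ge (Set.mem_range_self n)
  choose extend hextends hdefeat using fun (n : ℕ) (p : Condition) =>
    p.exists_extends_defeats (hmem n).1 (hmem n).2
  let p : ℕ → Condition := fun n => Nat.rec (Condition.ofBound g) extend n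
  obtain ⟨f, F, hf, hC, hF⟩ := exists_generic (p := p) fun n => hextends n (p n)
  refine ⟨coGraph F, loqHighForPaths_coGraph (hg f F hf hC), fun hWF => ?_⟩
  obtain ⟨Ψ, hΨ, mΨ, cΨ⟩ := exists_functional_of_computableIn_coGraph hWF
  obtain ⟨n, rfl⟩ := hΦ.le ⟨hΨ, mΨ⟩
  obtain ⟨x, hx⟩ := hdefeat n (p n)
  obtain ⟨k, hk⟩ := cΨ x
  exact hx _ (hF (n + 1) k) hk

end CFT
end
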